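/- Let 𝓛 = span_{ℤ[q]} B_i (which is independent of i). The basis B_i + q𝓛 of the ℤ-module 𝓛/q𝓛, i.e. the set of residues of the PBW monomials modulo q𝓛, is independent of the choice of reduced expression i of w_0. -/

import Mathlib

/-!
Common setup: the quantized universal enveloping algebra `U_q(𝔤)` of a simple
complex Lie algebra of type ADE, presented by the Chevalley generators
`E i`, `F i`, `K i`, `K i⁻¹` over `ℚ(q)`, together with the combinatorics of
words in the Weyl group, PBW root vectors and monomials, Lusztig's braid group
automorphisms, the bar involution, lattices, and partial orders on Lusztig data.
-/

noncomputable section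

open scoped BigOperators

/-- The base field `ℚ(q)`. -/
abbrev 𝕂 : Type := RatFunc ℚ

/-- The indeterminate `q ∈ ℚ(q)`. -/
noncomputable def qq : 𝕂 := RatFunc.X

/-- The Cartan matrix attached to an adjacency function: `2` on the diagonal,
`-1` for adjacent vertices, `0` otherwise. -/
def cartanOf {I : Type} [DecidableEq I] (adj : I → I → Bool) (i j : I) : ℤ :=
  if i = j then 2 else if adj i j then -1 else 0

/-- The datum of a simply laced (ADE) Dynkin diagram of a simple Lie algebra:
a finite nonempty vertex set with a symmetric irreflexive adjacency relation,
connected (simple `𝔤`), whose Cartan matrix is positive definite (finite type;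
together with simply-lacedness this characterizes types A, D, E). -/
structure ADEData (I : Type) [Fintype I] [DecidableEq I] : Type where
  nonE : Nonempty I
  adj : I → I → Bool
  symm : ∀ i j, adj i j = adj j i
  irrefl : ∀ i, adj i i = false
  conn : ∀ i j : I, Relation.ReflTransGen (fun a b => adj a b = true) i j
  posdef : ∀ v : I → ℚ, v ≠ 0 → 0 < ∑ i, ∑ j, (cartanOf adj i j : ℚ) * v i * v j

variable {I : Type} [Fintype I] [DecidableEq I]

/-- Generators `E i`, `F i`, `K i`, `K i⁻¹` of `U_q(𝔤)`. -/
inductive Gen (I : Type) : Type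
  | E : I → Gen I
  | F : I → Gen I
  | K : I → Gen I
  | Kinv : I → Gen I

/-- The free `ℚ(q)`-algebra on the generators. -/
abbrev FA (I : Type) := FreeAlgebra 𝕂 (Gen I)

def gE (i : I) : FA I := FreeAlgebra.ι 𝕂 (Gen.E i)
def gF (i : I) : FA I := FreeAlgebra.ι 𝕂 (Gen.F i)
def gK (i : I) : FA I := FreeAlgebra.ι 𝕂 (Gen.K i)
def gKinv (i : I) : FA I := FreeAlgebra.ι 𝕂 (Gen.Kinv i)

/-- The defining relations of `U_q(𝔤)` (type ADE). -/
inductive QRel (D : ADEData I) : FA I → FA I → Prop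
  | KKinv (i : I) : QRel D (gK i * gKinv i) 1
  | KinvK (i : I) : QRel D (gKinv i * gK i) 1
  | KcommK (i j : I) : QRel D (gK i * gK j) (gK j * gK i)
  | KEself (i : I) : QRel D (gK i * gE i * gKinv i) ((qq ^ 2) • gE i)
  | KFself (i : I) : QRel D (gK i * gF i * gKinv i) ((qq ^ 2)⁻¹ • gF i)
  | EFdiff (i j : I) (h : i ≠ j) : QRel D (gE i * gF j - gF j * gE i) 0
  | EFself (i : I) :
      QRel D (gE i * gF i - gF i * gE i) ((qq - qq⁻¹)⁻¹ • (gK i - gKinv i))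
  | serreE (i j : I) (h : D.adj i j = true) :
      QRel D (gE i ^ 2 * gE j + gE j * gE i ^ 2) ((qq + qq⁻¹) • (gE i * gE j * gE i))
  | serreF (i j : I) (h : D.adj i j = true) :
      QRel D (gF i ^ 2 * gF j + gF j * gF i ^ 2) ((qq + qq⁻¹) • (gF i * gF j * gF i))
  | KEadj (i j : I) (h : D.adj i j = true) :
      QRel D (gK i * gE j * gKinv i) (qq⁻¹ • gE j)
  | KFadj (i j : I) (h : D.adj i j = true) :
      QRel D (gK i * gF j * gKinv i) (qq • gF j)
  | EEfar (i j : I) (h : i ≠ j) (h' : D.adj i j = false) :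
      QRel D (gE i * gE j) (gE j * gE i)
  | FFfar (i j : I) (h : i ≠ j) (h' : D.adj i j = false) :
      QRel D (gF i * gF j) (gF j * gF i)
  | KEfar (i j : I) (h : i ≠ j) (h' : D.adj i j = false) :
      QRel D (gK i * gE j * gKinv i) (gE j)
  | KFfar (i j : I) (h : i ≠ j) (h' : D.adj i j = false) :
      QRel D (gK i * gF j * gKinv i) (gF j)

/-- The quantized universal enveloping algebra `U_q(𝔤)`. -/
abbrev Uq (D : ADEData I) := RingQuot (QRel D)

/-- The generator `E i` of `U_q(𝔤)`. -/
def EE (D : ADEData I) (i : I) : Uq D := RingQuot.mkAlgHom 𝕂 (QRel D) (gE i)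
/-- The generator `F i` of `U_q(𝔤)`. -/
def FF (D : ADEData I) (i : I) : Uq D := RingQuot.mkAlgHom 𝕂 (QRel D) (gF i)
/-- The generator `K i` of `U_q(𝔤)`. -/
def KK (D : ADEData I) (i : I) : Uq D := RingQuot.mkAlgHom 𝕂 (QRel D) (gK i)
/-- The generator `K i ⁻¹` of `U_q(𝔤)`. -/
def KKinv (D : ADEData I) (i : I) : Uq D := RingQuot.mkAlgHom 𝕂 (QRel D) (gKinv i)

/-- The quantum integer `[n] = q^{n-1} + q^{n-3} + ⋯ + q^{-n+1}`. -/
def qInt (n : ℕ) : 𝕂 := ∑ t ∈ Finset.range n, qq ^ ((n : ℤ) - 1 - 2 * (t : ℤ))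

/-- The quantum factorial `[n]! = [n][n-1]⋯[2][1]`. -/
def qFact (n : ℕ) : 𝕂 := ∏ t ∈ Finset.range n, qInt (t + 1)

/-- The `q`-divided power `X^{(n)} = X^n / [n]!`. -/
def dp {D : ADEData I} (x : Uq D) (n : ℕ) : Uq D := (qFact n)⁻¹ • x ^ n

/-- `U_q^-(𝔤)`: the subalgebra generated by the `F i`. -/
def Uminus (D : ADEData I) : Subalgebra 𝕂 (Uq D) :=
  Algebra.adjoin 𝕂 (Set.range (FF D))

/-- `U_q^{≥0}(𝔤)`: the subalgebra generated by the `E i` and `K i^{±1}`. -/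
def Ugeq0 (D : ADEData I) : Subalgebra 𝕂 (Uq D) :=
  Algebra.adjoin 𝕂 (Set.range (EE D) ∪ Set.range (KK D) ∪ Set.range (KKinv D))

/-- A family of algebra automorphisms `T i` is the family of Lusztig braid
automorphisms if it takes the prescribed values on all generators. -/
def IsLusztigAuts (D : ADEData I) (T : I → (Uq D ≃ₐ[𝕂] Uq D)) : Prop :=
  ∀ i j : I,
    (T i (FF D i) = -(KKinv D i * EE D i)) ∧
    (D.adj i j = true → T i (FF D j) = FF D j * FF D i - qq • (FF D i * FF D j)) ∧
    (i ≠ j → D.adj i j = false → T i (FF D j) = FF D j) ∧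
    (T i (EE D i) = -(FF D i * KK D i)) ∧
    (D.adj i j = true → T i (EE D j) = EE D i * EE D j - qq⁻¹ • (EE D j * EE D i)) ∧
    (i ≠ j → D.adj i j = false → T i (EE D j) = EE D j) ∧
    (T i (KK D i) = KKinv D i) ∧
    (D.adj i j = true → T i (KK D j) = KK D i * KK D j) ∧
    (i ≠ j → D.adj i j = false → T i (KK D j) = KK D j)

/-- The Cartan matrix of the diagram. -/
def cartan (D : ADEData I) : I → I → ℤ := cartanOf D.adj

/-- The simple root `α i`, as a vector in the root lattice `ℤ^I`. -/
def simpleRoot (i : I) : I → ℤ := fun j => if j = i then 1 else 0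

/-- The standard pairing `(v, α i)` on the root lattice. -/
def pairing (D : ADEData I) (v : I → ℤ) (i : I) : ℤ := ∑ j, v j * cartan D j i

/-- The simple reflection `s i` acting on the root lattice. -/
def sref (D : ADEData I) (i : I) (v : I → ℤ) : I → ℤ :=
  fun j => v j - pairing D v i * simpleRoot i j

/-- Action of a word `(i₁, …, i_N)` on the root lattice: `s_{i₁} ∘ ⋯ ∘ s_{i_N}`. -/
def wordAct (D : ADEData I) : List I → (I → ℤ) → (I → ℤ)
  | [] => fun v => v
  | i :: l => fun v => sref D i (wordAct D l v)

/-- A word in the generators of the Weyl group is reduced if no shorter word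
defines the same element (i.e., the same action on the root lattice). -/
def IsReducedWord (D : ADEData I) (w : List I) : Prop :=
  ∀ w' : List I, wordAct D w' = wordAct D w → w.length ≤ w'.length

/-- `w` is a reduced expression of the longest element `w₀` of the Weyl group. -/
def IsRedW0 (D : ADEData I) (w : List I) : Prop :=
  IsReducedWord D w ∧ ∀ w' : List I, IsReducedWord D w' → w'.length ≤ w.length

/-- The root `β_k = s_{i₁} ⋯ s_{i_{k-1}} (α_{i_k})` attached to the `k`-th letter
of the word `w` (here `k` is 0-indexed). -/
def beta (D : ADEData I) (w : List I) (k : Fin w.length) : I → ℤ :=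
  wordAct D (w.take k) (simpleRoot (w.get k))

/-- `v` is a root: it lies in the Weyl group orbit of a simple root. -/
def IsRoot (D : ADEData I) (v : I → ℤ) : Prop :=
  ∃ (l : List I) (i : I), v = wordAct D l (simpleRoot i)

/-- `v` is a positive root. -/
def IsPosRoot (D : ADEData I) (v : I → ℤ) : Prop :=
  IsRoot D v ∧ ∀ j, 0 ≤ v j

/-- Apply `T_{i₁} ∘ T_{i₂} ∘ ⋯ ∘ T_{i_m}` for a word `(i₁, …, i_m)`. -/
def applyT {D : ADEData I} (T : I → (Uq D ≃ₐ[𝕂] Uq D)) : List I → Uq D → Uq D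
  | [], x => x
  | i :: l, x => T i (applyT T l x)

/-- Apply `T_{i_m}^{-1} ∘ ⋯ ∘ T_{i₁}^{-1}` for a word `(i₁, …, i_m)`. -/
def applyTinv {D : ADEData I} (T : I → (Uq D ≃ₐ[𝕂] Uq D)) : List I → Uq D → Uq D
  | [], x => x
  | i :: l, x => applyTinv T l ((T i).symm x)

/-- The PBW root vector `F_{i;β_k} = T_{i₁} ⋯ T_{i_{k-1}} (F_{i_k})`
(`k` is 0-indexed). -/
def rootVec {D : ADEData I} (T : I → (Uq D ≃ₐ[𝕂] Uq D)) (w : List I)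
    (k : Fin w.length) : Uq D :=
  applyT T (w.take k) (FF D (w.get k))

/-- The PBW monomial `F^a = F_{β₁}^{(a₁)} F_{β₂}^{(a₂)} ⋯ F_{β_N}^{(a_N)}`
attached to the Lusztig datum `a`. -/
def pbw {D : ADEData I} (T : I → (Uq D ≃ₐ[𝕂] Uq D)) (w : List I)
    (a : Fin w.length → ℕ) : Uq D :=
  ((List.finRange w.length).map (fun k => dp (rootVec T w k) (a k))).prod

/-- `u` is a homogeneous element of weight `μ` for the root-lattice grading of
`U_q(𝔤)`: conjugation by `K i` multiplies it by `q^{(μ, α_i)}`. -/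
def HasWeight (D : ADEData I) (u : Uq D) (μ : I → ℤ) : Prop :=
  ∀ i, KK D i * u * KKinv D i = (qq ^ pairing D μ i) • u

/-- The weight `Σ_k a_k β_k` of a Lusztig datum. -/
def wtData (D : ADEData I) (w : List I) (a : Fin w.length → ℕ) : I → ℤ :=
  ∑ k, (a k : ℤ) • beta D w k

/-- `a` is less than `b` in the left lexicographic order on Lusztig data:
at the first index where they differ, `a` is **bigger**. -/
def LtLeft {N : ℕ} (a b : Fin N → ℕ) : Prop :=
  ∃ k, b k < a k ∧ ∀ l, l < k → a l = b l

/-- `a` is less than `b` in the right lexicographic order on Lusztig data: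
at the last index where they differ, `a` is **bigger**. -/
def LtRight {N : ℕ} (a b : Fin N → ℕ) : Prop :=
  ∃ k, b k < a k ∧ ∀ l, k < l → a l = b l

/-- The partial order `≺` on Lusztig data: same weight, and strictly smaller in
both lexicographic orders. -/
def Prec (D : ADEData I) (w : List I) (a b : Fin w.length → ℕ) : Prop :=
  wtData D w a = wtData D w b ∧ LtLeft a b ∧ LtRight a b

/-- Two words are related by a single braid move. -/
def BraidMove (D : ADEData I) (w w' : List I) : Prop :=
  (∃ (w₁ w₂ : List I) (a b : I), a ≠ b ∧ D.adj a b = false ∧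
      w = w₁ ++ a :: b :: w₂ ∧ w' = w₁ ++ b :: a :: w₂) ∨
  (∃ (w₁ w₂ : List I) (a b : I), D.adj a b = true ∧
      w = w₁ ++ a :: b :: a :: w₂ ∧ w' = w₁ ++ b :: a :: b :: w₂)

instance : Algebra (Polynomial ℤ) 𝕂 :=
  ((Polynomial.aeval qq : Polynomial ℤ →ₐ[ℤ] 𝕂)).toRingHom.toAlgebra

instance (D : ADEData I) : Module (Polynomial ℤ) (Uq D) :=
  Module.compHom _ (algebraMap (Polynomial ℤ) 𝕂)

/-- The `ℤ[q]`-lattice `𝓛` spanned by the PBW monomials of `B_i`. -/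
def latt {D : ADEData I} (T : I → (Uq D ≃ₐ[𝕂] Uq D)) (w : List I) :
    Submodule (Polynomial ℤ) (Uq D) :=
  Submodule.span (Polynomial ℤ) (Set.range (pbw T w))

/-- The sublattice `q𝓛`. -/
def qlatt {D : ADEData I} (T : I → (Uq D ≃ₐ[𝕂] Uq D)) (w : List I) :
    Submodule (Polynomial ℤ) (Uq D) :=
  Submodule.span (Polynomial ℤ) ((fun x => qq • x) '' ((latt T w : Submodule (Polynomial ℤ) (Uq D)) : Set (Uq D)))

/-- `bar` is the bar involution: the `ℚ`-algebra involution fixing `E i` and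
`F i`, sending `K i` to `K i⁻¹` and `q` to `q⁻¹`. -/
def IsBar (D : ADEData I) (bar : Uq D →+* Uq D) : Prop :=
  (∀ i, bar (EE D i) = EE D i) ∧ (∀ i, bar (FF D i) = FF D i) ∧
  (∀ i, bar (KK D i) = KKinv D i) ∧
  bar (algebraMap 𝕂 (Uq D) qq) = algebraMap 𝕂 (Uq D) qq⁻¹ ∧
  ∀ x, bar (bar x) = x

/-- `c ∈ ℚ(q)` is a Laurent polynomial in `q`. -/
def IsLaurent (c : 𝕂) : Prop :=
  ∃ (f : Polynomial ℚ) (m : ℕ), c = qq⁻¹ ^ m * Polynomial.aeval qq f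

/-- `b` is (an indexing of) the canonical basis: it lies in the lattice `𝓛`,
its residues mod `q𝓛` are the residues of the PBW monomials, and it is
bar-invariant. -/
def IsCanBasis {D : ADEData I} (T : I → (Uq D ≃ₐ[𝕂] Uq D)) (w : List I)
    (bar : Uq D →+* Uq D) (b : (Fin w.length → ℕ) → Uq D) : Prop :=
  (∀ a, b a ∈ latt T w) ∧ (∀ a, b a - pbw T w a ∈ qlatt T w) ∧ (∀ a, bar (b a) = b a)

/-- The braid move from `w` to `w'` does not change the relative position of the
roots `u` and `v` in the enumerations of positive roots attached to `w`, `w'`. -/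
def SameRelPos (D : ADEData I) (w w' : List I) (u v : I → ℤ) : Prop :=
  ∀ (k l : Fin w.length) (k' l' : Fin w'.length),
    beta D w k = u → beta D w l = v → beta D w' k' = u → beta D w' l' = v →
    ((k : ℕ) < (l : ℕ) ↔ (k' : ℕ) < (l' : ℕ))

/-- The subring `ℚ[q]₀ ⊆ ℚ(q)` of rational functions regular at `q = 0`. -/
def Reg0 : Subring 𝕂 where
  carrier := {x | ∃ f g : Polynomial ℚ, Polynomial.eval 0 g ≠ 0 ∧
    x * algebraMap (Polynomial ℚ) 𝕂 g = algebraMap (Polynomial ℚ) 𝕂 f}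
  zero_mem' := ⟨0, 1, by simp, by simp⟩
  one_mem' := ⟨1, 1, by simp, by simp⟩
  add_mem' := by
    rintro x y ⟨f1, g1, h1, e1⟩ ⟨f2, g2, h2, e2⟩
    refine ⟨f1 * g2 + f2 * g1, g1 * g2, by simpa using mul_ne_zero h1 h2, ?_⟩
    rw [map_mul, map_add, map_mul, map_mul, ← e1, ← e2]; ring
  mul_mem' := by
    rintro x y ⟨f1, g1, h1, e1⟩ ⟨f2, g2, h2, e2⟩
    refine ⟨f1 * f2, g1 * g2, by simpa using mul_ne_zero h1 h2, ?_⟩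
    rw [map_mul, map_mul, ← e1, ← e2]; ring
  neg_mem' := by
    rintro x ⟨f, g, h, e⟩
    exact ⟨-f, g, h, by rw [map_neg, ← e]; ring⟩

instance (D : ADEData I) : Module ↥Reg0 (Uq D) :=
  Module.compHom _ (Reg0.subtype)

/-- Iterated application of a family of operators along a word. -/
def applyOps {D : ADEData I} (Ft : I → Uq D → Uq D) : List I → Uq D → Uq D
  | [], x => x
  | i :: l, x => Ft i (applyOps Ft l x)

/-- Kashiwara's lattice `𝓛(∞)`: the `ℚ[q]₀`-span of all elements obtained from
`1` by applying sequences of the Kashiwara operators. -/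
def lattInf {D : ADEData I} (Ft : I → Uq D → Uq D) : Submodule ↥Reg0 (Uq D) :=
  Submodule.span ↥Reg0 {x : Uq D | ∃ l : List I, x = applyOps Ft l 1}

/-- The sublattice `q𝓛(∞)`. -/
def qlattInf {D : ADEData I} (Ft : I → Uq D → Uq D) : Submodule ↥Reg0 (Uq D) :=
  Submodule.span ↥Reg0 ((fun x => qq • x) '' ((lattInf Ft : Submodule ↥Reg0 (Uq D)) : Set (Uq D)))

end

noncomputable section
open scoped BigOperators
open Polynomial (aeval)

lemma qq_ne : qq ≠ 0 := RatFunc.X_ne_zero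

lemma qq_pow_ne (n : ℕ) (hn : n ≠ 0) : qq ^ n ≠ 1 := by
  intro h
  have h1 : algebraMap (Polynomial ℚ) 𝕂 (Polynomial.X ^ n) = algebraMap (Polynomial ℚ) 𝕂 1 := by
    rw [map_pow, RatFunc.algebraMap_X, map_one]; exact h
  have h2 := RatFunc.algebraMap_injective ℚ h1
  have h3 := congrArg Polynomial.natDegree h2
  simp at h3
  exact hn h3

lemma qdiff_ne : qq - qq⁻¹ ≠ 0 := by
  intro h
  apply qq_pow_ne 2 (by norm_num)
  have : qq = qq⁻¹ := sub_eq_zero.1 h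
  rw [pow_two]
  nth_rewrite 2 [this]
  exact mul_inv_cancel₀ qq_ne

def qz (n : ℤ) : 𝕂 := (qq ^ n - qq ^ (-n)) / (qq - qq⁻¹)

lemma qz_zero : qz 0 = 0 := by simp [qz]
lemma qz_one : qz 1 = 1 := by
  simp only [qz, zpow_one, zpow_neg]
  exact div_self qdiff_ne

lemma qz_add (a b : ℤ) : qz (a + b) = qq ^ (-b) * qz a + qq ^ a * qz b := by
  simp only [qz, mul_div_assoc', ← add_div]
  congr 1
  rw [neg_add, zpow_add₀ qq_ne, zpow_add₀ qq_ne]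
  ring

lemma qInt_eq (n : ℕ) : qInt n = qz n := by
  rw [qz, eq_div_iff qdiff_ne, qInt, Finset.sum_mul]
  have : ∀ t ∈ Finset.range n, qq ^ ((n : ℤ) - 1 - 2 * (t : ℤ)) * (qq - qq⁻¹)
      = qq ^ ((n : ℤ) - 2 * (t : ℤ)) - qq ^ ((n : ℤ) - 2 * ((t + 1 : ℕ) : ℤ)) := by
    intro t _
    rw [mul_sub, ← zpow_add_one₀ qq_ne, ← zpow_sub_one₀ qq_ne]
    congr 2 <;> push_cast <;> ring
  rw [Finset.sum_congr rfl this, Finset.sum_range_sub' (fun t => qq ^ ((n : ℤ) - 2 * (t : ℤ)))]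
  congr 2
  ring

lemma qz_ne (n : ℕ) : qz (n + 1) ≠ 0 := by
  rw [qz]
  apply div_ne_zero _ qdiff_ne
  intro h
  apply qq_pow_ne (2 * (n + 1)) (by omega)
  have h := sub_eq_zero.1 h
  have h2 : qq ^ ((n : ℤ) + 1) * qq ^ ((n : ℤ) + 1) = 1 := by
    nth_rewrite 2 [h]
    rw [← zpow_add₀ qq_ne]; simp
  rw [two_mul, pow_add]
  exact_mod_cast h2

lemma qFact_succ (n : ℕ) : qFact (n + 1) = qFact n * qz (n + 1) := by
  rw [qFact, Finset.prod_range_succ, ← qFact, qInt_eq]; push_cast; rfl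

lemma qFact_zero : qFact 0 = 1 := by simp [qFact]

lemma qFact_ne (n : ℕ) : qFact n ≠ 0 := by
  induction n with
  | zero => simp [qFact]
  | succ n ih => rw [qFact_succ]; exact mul_ne_zero ih (qz_ne n)

section gen
variable {A : Type} [Ring A] [Algebra 𝕂 A]

def gdp (x : A) (n : ℕ) : A := (qFact n)⁻¹ • x ^ n

def dz (x : A) (n : ℤ) : A := if 0 ≤ n then gdp x n.toNat else 0

lemma gdp_zero (x : A) : gdp x 0 = 1 := by simp [gdp, qFact_zero]
lemma dz_nat (x : A) (n : ℕ) : dz x n = gdp x n := by simp [dz]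
lemma dz_neg (x : A) (n : ℤ) (h : n < 0) : dz x n = 0 := by simp [dz, h]
lemma dz_zero (x : A) : dz x 0 = 1 := by simpa [gdp_zero] using dz_nat x 0

lemma gdp_mul (x : A) (n : ℕ) : gdp x n * x = qz (n + 1) • gdp x (n + 1) := by
  rw [gdp, gdp, qFact_succ, smul_smul, mul_inv, pow_succ, smul_mul_assoc]
  congr 1
  have := qz_ne n; have := qFact_ne n
  field_simp

lemma mul_gdp (x : A) (n : ℕ) : x * gdp x n = qz (n + 1) • gdp x (n + 1) := by
  rw [← gdp_mul, gdp, mul_smul_comm, smul_mul_assoc, ← pow_succ, ← pow_succ']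

lemma dz_mul (x : A) (n : ℤ) : dz x n * x = qz (n + 1) • dz x (n + 1) := by
  rcases lt_trichotomy n (-1) with h | h | h
  · rw [dz_neg _ _ (by omega), dz_neg _ _ (by omega)]; simp
  · subst h; rw [dz_neg _ _ (by omega)]; simp [qz_zero]
  · lift n to ℕ using by omega
    have := dz_nat x (n+1); push_cast at this
    rw [this, dz_nat, gdp_mul]

lemma mul_dz (x : A) (n : ℤ) : x * dz x n = qz (n + 1) • dz x (n + 1) := by
  rcases lt_trichotomy n (-1) with h | h | h
  · rw [dz_neg _ _ (by omega), dz_neg _ _ (by omega)]; simp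
  · subst h; rw [dz_neg _ _ (by omega)]; simp [qz_zero]
  · lift n to ℕ using by omega
    have := dz_nat x (n+1); push_cast at this
    rw [this, dz_nat, mul_gdp]

/-- the middle root vector -/
def yv (x z : A) : A := z * x - qq • (x * z)

def Serre (x z : A) : Prop := x ^ 2 * z + z * x ^ 2 = (qq + qq⁻¹) • (x * z * x)

lemma zx (x z : A) : z * x = qq • (x * z) + yv x z := by simp [yv]

lemma yx {x z : A} (h : Serre x z) : yv x z * x = qq⁻¹ • (x * yv x z) := by
  have h' : z * x ^ 2 = (qq + qq⁻¹) • (x * z * x) - x ^ 2 * z := by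
    rw [← h]; abel
  simp only [yv, sub_mul, mul_sub, smul_sub, smul_mul_assoc, mul_smul_comm, smul_smul,
    inv_mul_cancel₀ qq_ne, one_smul]
  rw [mul_assoc, ← pow_two, h', add_smul, ← mul_assoc, ← mul_assoc, ← pow_two]
  abel

lemma zy {x z : A} (h : Serre z x) : z * yv x z = qq⁻¹ • (yv x z * z) := by
  have h' : z ^ 2 * x = (qq + qq⁻¹) • (z * x * z) - x * z ^ 2 := by
    rw [← h]; abel
  simp only [yv, sub_mul, mul_sub, smul_sub, smul_mul_assoc, mul_smul_comm, smul_smul,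
    inv_mul_cancel₀ qq_ne, one_smul]
  rw [← mul_assoc, ← pow_two, h', add_smul, mul_assoc x z z, ← pow_two, ← mul_assoc]
  abel

lemma z_gdp_x {x z : A} (h : Serre x z) (l : ℕ) :
    z * gdp x l = qq ^ l • (gdp x l * z) + dz x (l - 1) * yv x z := by
  induction l with
  | zero => simp [gdp_zero, dz_neg]
  | succ l ih =>
    have e : (((l + 1 : ℕ) : ℤ) - 1) = l := by push_cast; ring
    rw [e]
    have hne := qz_ne l
    have key : qz (l + 1) • (z * gdp x (l + 1)) =
        qz (l + 1) • (qq ^ (l + 1) • (gdp x (l + 1) * z) + dz x l * yv x z) := by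
      rw [← mul_smul_comm, ← gdp_mul, ← mul_assoc, ih, add_mul, smul_mul_assoc, mul_assoc,
        zx x z, mul_assoc, yx h, mul_smul_comm, ← mul_assoc, dz_mul, mul_add, mul_smul_comm,
        ← mul_assoc, gdp_mul, smul_add, qz_add, qz_one]
      rw [sub_add_cancel, dz_nat]
      simp only [smul_mul_assoc, smul_add, smul_smul, add_assoc, ← add_smul]
      congr 2
      · rw [pow_succ]; ring
      · rw [zpow_neg_one, zpow_natCast]; ring
    exact (smul_right_injective A hne) key

lemma z_dz_x {x z : A} (h : Serre x z) (l : ℤ) :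
    z * dz x l = qq ^ l • (dz x l * z) + dz x (l - 1) * yv x z := by
  rcases lt_or_ge l 0 with hl | hl
  · simp [dz_neg x l hl, dz_neg x (l - 1) (by omega)]
  · lift l to ℕ using hl
    rw [dz_nat, z_gdp_x h, zpow_natCast]

lemma z_dz_y {x z : A} (h : Serre z x) (k : ℕ) :
    z * dz (yv x z) k = qq ^ (-(k : ℤ)) • (dz (yv x z) k * z) := by
  rw [dz_nat, gdp, mul_smul_comm, smul_mul_assoc, smul_comm (qq ^ (-(k : ℤ)))]
  congr 1
  induction k with
  | zero => simp
  | succ k ih =>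
    rw [pow_succ, ← mul_assoc, ih, smul_mul_assoc, mul_assoc, zy h, mul_smul_comm, smul_smul,
      mul_assoc]
    congr 1
    rw [← zpow_sub_one₀ qq_ne]; congr 1; push_cast; ring

lemma zn_xl {x z : A} (h : Serre x z) (h' : Serre z x) (l : ℤ) (n : ℕ) :
    dz z n * dz x l = ∑ k ∈ Finset.range (n + 1),
      qq ^ ((l - k) * (n - k)) • (dz x (l - k) * dz (yv x z) k * dz z (n - k)) := by
  induction n with
  | zero => simp [dz_zero]
  | succ n ih =>
    have key : qz (n + 1) • (dz z (n + 1 : ℕ) * dz x l) = qz (n + 1) •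
      ∑ k ∈ Finset.range (n + 1 + 1), qq ^ ((l - k) * ((n + 1 : ℕ) - k)) •
        (dz x (l - k) * dz (yv x z) k * dz z ((n + 1 : ℕ) - k)) := by
      push_cast
      rw [← smul_mul_assoc, ← mul_dz, mul_assoc, ih, Finset.mul_sum, Finset.smul_sum]
      have e1 : ∀ k ∈ Finset.range (n + 1 + 1), qz (n + 1) • qq ^ ((l - k) * ((n + 1 : ℤ) - k)) •
        (dz x (l - k) * dz (yv x z) k * dz z ((n + 1 : ℤ) - k)) =
        (qq ^ ((l - k) * ((n + 1 : ℤ) - k)) * (qq ^ (-(k : ℤ)) * qz (n + 1 - k))) •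
          (dz x (l - k) * dz (yv x z) k * dz z ((n + 1 : ℤ) - k))
        + (qq ^ ((l - k) * ((n + 1 : ℤ) - k)) * (qq ^ ((n : ℤ) + 1 - k) * qz k)) •
          (dz x (l - k) * dz (yv x z) k * dz z ((n + 1 : ℤ) - k)) := by
        intro k _
        have : qz (n + 1) = qz ((n + 1 - k) + k) := by congr 1; ring
        rw [this, qz_add, smul_smul, ← add_smul]
        congr 1; ring
      rw [Finset.sum_congr rfl e1, Finset.sum_add_distrib, Finset.sum_range_succ _ (n + 1),
        Finset.sum_range_succ' (fun k : ℕ => (qq ^ ((l - k) * ((n + 1 : ℤ) - k)) *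
          (qq ^ ((n : ℤ) + 1 - k) * qz k)) •
          (dz x (l - k) * dz (yv x z) k * dz z ((n + 1 : ℤ) - k)))]
      have e2 : qz ((n : ℤ) + 1 - ((n + 1 : ℕ) : ℤ)) = 0 := by
        push_cast; rw [sub_self, qz_zero]
      rw [e2, Nat.cast_zero, qz_zero]
      simp only [mul_zero, zero_smul, add_zero]
      rw [← Finset.sum_add_distrib]
      apply Finset.sum_congr rfl
      intro k _
      rw [mul_smul_comm, ← mul_assoc, ← mul_assoc, z_dz_x h, add_mul, smul_mul_assoc,
        mul_assoc _ z, z_dz_y h', mul_assoc (dz x (l - ↑k - 1)), mul_dz, mul_smul_comm,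
        mul_smul_comm, add_mul]
      simp only [smul_mul_assoc]
      rw [← mul_assoc, mul_assoc _ z, mul_dz, mul_smul_comm, smul_add]
      simp only [smul_smul]
      have a1 : (n : ℤ) - k + 1 = n + 1 - k := by ring
      have a2 : l - k - 1 = l - (k + 1 : ℕ) := by push_cast; ring
      have a3 : (n : ℤ) - k = n + 1 - (k + 1 : ℕ) := by push_cast; ring
      rw [a1, a2]
      congr 1
      · congr 1
        have : (l - k) * ((n : ℤ) + 1 - k) = (l - k) * (n - k) + (l - k) := by ring
        rw [this, zpow_add₀ qq_ne _ (l - k)]; ring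
      · rw [a3]
        push_cast
        congr 1
        rw [← mul_assoc, ← zpow_add₀ qq_ne]
        congr 2
        ring
    exact (smul_right_injective A (qz_ne n)) key

lemma zn_xl_nat {x z : A} (h : Serre x z) (h' : Serre z x) (n l m : ℕ) (hm : m = min n l) :
    gdp z n * gdp x l = ∑ k ∈ Finset.range (m + 1),
      qq ^ ((l - k) * (n - k)) • (gdp x (l - k) * gdp (yv x z) k * gdp z (n - k)) := by
  rw [← dz_nat, ← dz_nat, zn_xl h h']
  symm
  apply Finset.sum_subset_zero_on_sdiff
  · intro k; simp; omega
  · intro k hk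
    simp at hk
    rw [dz_neg x]
    · simp
    · omega
  · intro k hk
    simp at hk
    have a1 : (l : ℤ) - k = (l - k : ℕ) := by omega
    have a2 : (n : ℤ) - k = (n - k : ℕ) := by omega
    rw [a1, a2, dz_nat, dz_nat, dz_nat, ← Nat.cast_mul, zpow_natCast]

end gen

def qbin (a b : ℕ) : 𝕂 := qFact (a + b) / (qFact a * qFact b)

def IsZq (c : 𝕂) : Prop := ∃ p : Polynomial ℤ, algebraMap (Polynomial ℤ) 𝕂 p = c

lemma IsZq.add {a b : 𝕂} : IsZq a → IsZq b → IsZq (a + b) := by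
  rintro ⟨p, rfl⟩ ⟨r, rfl⟩; exact ⟨p + r, map_add _ _ _⟩
lemma IsZq.mul {a b : 𝕂} : IsZq a → IsZq b → IsZq (a * b) := by
  rintro ⟨p, rfl⟩ ⟨r, rfl⟩; exact ⟨p * r, map_mul _ _ _⟩
lemma IsZq.one : IsZq 1 := ⟨1, map_one _⟩
lemma algX : algebraMap (Polynomial ℤ) 𝕂 Polynomial.X = qq := Polynomial.aeval_X qq
lemma IsZq.q : IsZq qq := ⟨Polynomial.X, algX⟩
lemma IsZq.qpow (n : ℕ) : IsZq (qq ^ n) := ⟨Polynomial.X ^ n, by rw [map_pow, algX]⟩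

lemma qbin_mul {A : Type} [Ring A] [Algebra 𝕂 A] (x : A) (a b : ℕ) :
    gdp x a * gdp x b = qbin a b • gdp x (a + b) := by
  simp only [gdp, qbin, smul_mul_smul_comm, smul_smul, pow_add]
  congr 1
  have := qFact_ne a; have := qFact_ne b; have := qFact_ne (a + b)
  field_simp

lemma qbin_succ (a b : ℕ) : qq ^ ((a + 1) * (b + 1)) * qbin (a + 1) (b + 1) =
    qq ^ (a * (b + 1)) * qbin a (b + 1)
      + qq ^ (2 * (a + 1)) * (qq ^ ((a + 1) * b) * qbin (a + 1) b) := by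
  have e : qFact (a + 1 + (b + 1)) = qFact (a + b + 1) *
      (qq ^ (-((b : ℤ) + 1)) * qz (a + 1) + qq ^ ((a : ℤ) + 1) * qz (b + 1)) := by
    rw [show a + 1 + (b + 1) = (a + b + 1) + 1 by ring, qFact_succ, ← qz_add]
    congr 2; push_cast; ring
  rw [qbin, qbin, qbin, e, show a + (b + 1) = a + b + 1 by ring,
    show a + 1 + b = a + b + 1 by ring, qFact_succ a, qFact_succ b]
  have := qFact_ne a; have := qFact_ne b; have := qFact_ne (a + b + 1)
  have := qz_ne a; have := qz_ne b
  have hq := qq_ne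
  rw [zpow_neg]
  have e1 : qq ^ ((b : ℤ) + 1) = qq ^ (b + 1) := by exact_mod_cast zpow_natCast qq (b + 1)
  have e2 : qq ^ ((a : ℤ) + 1) = qq ^ (a + 1) := by exact_mod_cast zpow_natCast qq (a + 1)
  rw [e1, e2]
  have e3 : qq ^ ((a + 1) * (b + 1)) = qq ^ (a * (b + 1)) * qq ^ (b + 1) := by ring
  have e4 : qq ^ (2 * (a + 1)) * qq ^ ((a + 1) * b) = qq ^ (a * (b + 1)) * qq ^ (b + 1) * qq ^ (a + 1) := by ring
  rw [← mul_assoc _ _ (_ / _), e4, e3]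
  generalize qq ^ (a * (b + 1)) = X
  have hne : qq ^ (b + 1) ≠ 0 := pow_ne_zero _ hq
  generalize qq ^ (b + 1) = Y at *
  generalize qq ^ (a + 1) = Z
  field_simp

lemma qbin_Zq (a b : ℕ) : IsZq (qq ^ (a * b) * qbin a b) := by
  induction a generalizing b with
  | zero =>
    have : qbin 0 b = 1 := by rw [qbin, qFact_zero, one_mul, zero_add, div_self (qFact_ne b)]
    rw [this]; simpa using IsZq.one
  | succ a iha =>
    induction b with
    | zero =>
      have : qbin (a + 1) 0 = 1 := by rw [qbin, qFact_zero, mul_one, add_zero, div_self (qFact_ne _)]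
      rw [this]; simpa using IsZq.one
    | succ b ihb =>
      rw [qbin_succ]
      exact (iha _).add ((IsZq.qpow _).mul ihb)

lemma qbin_symm (a b : ℕ) : qbin a b = qbin b a := by
  rw [qbin, qbin, add_comm, mul_comm]

end

noncomputable section
open scoped BigOperators

set_option linter.unusedSectionVars false

section lat
variable {A : Type} [Ring A] [Algebra 𝕂 A] [Module (Polynomial ℤ) A]
  [IsScalarTower (Polynomial ℤ) 𝕂 A]

abbrev gL (S : Set A) : Submodule (Polynomial ℤ) A := Submodule.span (Polynomial ℤ) S
def gqL (S : Set A) : Submodule (Polynomial ℤ) A :=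
  Submodule.span (Polynomial ℤ) ((fun x => qq • x) '' (gL S : Set A))

lemma zq_smul_mem {c : 𝕂} (hc : IsZq c) (N : Submodule (Polynomial ℤ) A) {x : A} (hx : x ∈ N) :
    c • x ∈ N := by
  obtain ⟨p, rfl⟩ := hc
  rw [algebraMap_smul]
  exact N.smul_mem p hx

lemma q_smul_mem {S : Set A} {x : A} (hx : x ∈ gL S) : qq • x ∈ gqL S :=
  Submodule.subset_span ⟨x, hx, rfl⟩

lemma gqL_le (S : Set A) : gqL S ≤ gL S := by
  rw [gqL, Submodule.span_le]
  rintro _ ⟨x, hx, rfl⟩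
  exact zq_smul_mem IsZq.q _ hx

lemma gL_map {S S' : Set A} (f : A →ₗ[𝕂] A) (h : ∀ s ∈ S, f s ∈ gL S') {x : A} (hx : x ∈ gL S) :
    f x ∈ gL S' := by
  have : gL S ≤ (gL S').comap (f.restrictScalars (Polynomial ℤ)) := by
    rw [Submodule.span_le]; exact h
  exact this hx

lemma gqL_map {S S' : Set A} (f : A →ₗ[𝕂] A) (h : ∀ s ∈ S, f s ∈ gL S') {x : A}
    (hx : x ∈ gqL S) : f x ∈ gqL S' := by
  have : gqL S ≤ (gqL S').comap (f.restrictScalars (Polynomial ℤ)) := by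
    rw [gqL, Submodule.span_le]
    rintro _ ⟨y, hy, rfl⟩
    change f (qq • y) ∈ gqL S'
    rw [map_smul]
    exact q_smul_mem (gL_map f h hy)
  exact this hx

lemma gqL_mono {S S' : Set A} (h : ∀ s ∈ S, s ∈ gL S') : gqL S ≤ gqL S' :=
  fun _ hx => gqL_map LinearMap.id h hx

/-- every element of `S` is congruent to an element of `S'` modulo `q L(S')`. -/
def Dir (S S' : Set A) : Prop := ∀ s ∈ S, ∃ s' ∈ S', s - s' ∈ gqL S'

lemma Dir.le {S S' : Set A} (h : Dir S S') : ∀ s ∈ S, s ∈ gL S' := by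
  intro s hs
  obtain ⟨s', hs', hd⟩ := h s hs
  have := (gL S').add_mem (gqL_le _ hd) (Submodule.subset_span hs')
  simpa using this

lemma Dir.trans {S S' S'' : Set A} (h : Dir S S') (h' : Dir S' S'') : Dir S S'' := by
  intro s hs
  obtain ⟨s', hs', hd⟩ := h s hs
  obtain ⟨s'', hs'', hd'⟩ := h' s' hs'
  refine ⟨s'', hs'', ?_⟩
  have := (gqL S'').add_mem (gqL_mono h'.le hd) hd'
  simpa using this

lemma Dir.refl (S : Set A) : Dir S S := fun s hs => ⟨s, hs, by simp⟩

def mon (x z : A) (l m n : ℕ) : A := gdp x l * gdp (yv x z) m * gdp z n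

def PB (x z : A) : Set A := {u | ∃ l m n, u = mon x z l m n}

def CB (x z : A) : Set A :=
  {u | ∃ p r s : ℕ, p + s ≤ r ∧
    (u = gdp z p * gdp x r * gdp z s ∨ u = gdp x p * gdp z r * gdp x s)}

lemma CB_symm (x z : A) : CB x z = CB z x := by
  ext u
  constructor <;> rintro ⟨p, r, s, h, h1 | h1⟩ <;> exact ⟨p, r, s, h, by tauto⟩

lemma coef_eq (a b e : ℕ) : qq ^ (a * b + (e + 1)) * qbin a b
    = qq * (qq ^ e * (qq ^ (a * b) * qbin a b)) := by
  rw [pow_add, pow_succ]; ring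

lemma cb1 {x z : A} (h : Serre x z) (h' : Serre z x) (p r s : ℕ) (hr : p + s ≤ r) :
    ∃ c : ℕ → 𝕂, (∀ k, IsZq (c k)) ∧ gdp z p * gdp x r * gdp z s = mon x z (r - p) p s +
      ∑ k ∈ Finset.range p, (qq * c k) • mon x z (r - k) k (p - k + s) := by
  refine ⟨fun k => qq ^ ((p - k) * (r - k - s) - 1) * (qq ^ ((p - k) * s) * qbin (p - k) s),
    fun k => (IsZq.qpow _).mul (qbin_Zq _ _), ?_⟩
  rw [zn_xl_nat h h' p r p (by omega), Finset.sum_mul, Finset.sum_range_succ, add_comm]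
  congr 1
  · simp [mon, gdp_zero]
  · apply Finset.sum_congr rfl
    intro k hk
    simp at hk
    rw [smul_mul_assoc, mul_assoc _ (gdp z (p - k)), qbin_mul, mul_smul_comm, smul_smul, ← coef_eq]
    congr 3
    obtain ⟨d, rfl⟩ := Nat.exists_eq_add_of_lt hk
    obtain ⟨e, rfl⟩ := Nat.exists_eq_add_of_le hr
    have e1 : k + d + 1 - k = d + 1 := by omega
    have e2 : k + d + 1 + s + e - k = d + 1 + s + e := by omega
    have e3 : d + 1 + s + e - s = d + 1 + e := by omega
    rw [e1, e2, e3]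
    have : 0 < (d + 1) * (d + 1 + e) := by positivity
    rw [Nat.sub_add_cancel this]; ring

lemma cb2 {x z : A} (h : Serre x z) (h' : Serre z x) (p r s : ℕ) (hr : p + s ≤ r) :
    ∃ c : ℕ → 𝕂, (∀ k, IsZq (c k)) ∧ gdp x p * gdp z r * gdp x s = mon x z p s (r - s) +
      ∑ k ∈ Finset.range s, (qq * c k) • mon x z (p + (s - k)) k (r - k) := by
  refine ⟨fun k => qq ^ ((s - k) * (r - k - p) - 1) * (qq ^ (p * (s - k)) * qbin p (s - k)),
    fun k => (IsZq.qpow _).mul (qbin_Zq _ _), ?_⟩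
  rw [mul_assoc, zn_xl_nat h h' r s s (by omega), Finset.mul_sum, Finset.sum_range_succ, add_comm]
  congr 1
  · simp [mon, gdp_zero, mul_assoc]
  · apply Finset.sum_congr rfl
    intro k hk
    simp at hk
    rw [mul_smul_comm, ← mul_assoc, ← mul_assoc, qbin_mul, smul_mul_assoc, smul_mul_assoc,
      smul_smul, ← coef_eq]
    congr 3
    obtain ⟨d, rfl⟩ := Nat.exists_eq_add_of_lt hk
    obtain ⟨e, rfl⟩ := Nat.exists_eq_add_of_le hr
    have e1 : k + d + 1 - k = d + 1 := by omega
    have e2 : p + (k + d + 1) + e - k = p + (d + 1 + e) := by omega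
    have e3 : p + (d + 1 + e) - p = d + 1 + e := by omega
    rw [e1, e2, e3]
    have : 0 < (d + 1) * (d + 1 + e) := by positivity
    rw [Nat.sub_add_cancel this]; ring

lemma sum_mem_gqL {S : Set A} {n : ℕ} {c : ℕ → 𝕂} (hc : ∀ k, IsZq (c k)) {f : ℕ → A}
    (hf : ∀ k < n, f k ∈ gL S) : ∑ k ∈ Finset.range n, (qq * c k) • f k ∈ gqL S := by
  apply Submodule.sum_mem
  intro k hk
  rw [mul_smul]
  exact q_smul_mem (zq_smul_mem (hc k) _ (hf k (Finset.mem_range.1 hk)))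

lemma CB_PB {x z : A} (h : Serre x z) (h' : Serre z x) : Dir (CB x z) (PB x z) := by
  rintro _ ⟨p, r, s, hr, rfl | rfl⟩
  · obtain ⟨c, hc, e⟩ := cb1 h h' p r s hr
    refine ⟨mon x z (r - p) p s, ⟨_, _, _, rfl⟩, ?_⟩
    rw [e, add_sub_cancel_left]
    exact sum_mem_gqL hc fun k _ => Submodule.subset_span ⟨_, _, _, rfl⟩
  · obtain ⟨c, hc, e⟩ := cb2 h h' p r s hr
    refine ⟨mon x z p s (r - s), ⟨_, _, _, rfl⟩, ?_⟩
    rw [e, add_sub_cancel_left]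
    exact sum_mem_gqL hc fun k _ => Submodule.subset_span ⟨_, _, _, rfl⟩

lemma PB_CB {x z : A} (h : Serre x z) (h' : Serre z x) : Dir (PB x z) (CB x z) := by
  rintro _ ⟨l, m, n, rfl⟩
  have key : ∀ t u : A, t - (t + u) = -u := by intro t u; abel
  have mem : ∀ t s : A, s ∈ CB x z → t - s ∈ gqL (CB x z) → t ∈ gL (CB x z) := by
    intro t s hs ht
    simpa using (gL (CB x z)).add_mem (gqL_le _ ht) (Submodule.subset_span hs)
  rcases le_total n l with hl | hl
  · have : gdp z m * gdp x (l + m) * gdp z n ∈ CB x z ∧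
        mon x z l m n - gdp z m * gdp x (l + m) * gdp z n ∈ gqL (CB x z) := by
      induction m using Nat.strong_induction_on generalizing l n with
      | _ m ih =>
        refine ⟨⟨m, l + m, n, by omega, Or.inl rfl⟩, ?_⟩
        obtain ⟨c, hc, e⟩ := cb1 h h' m (l + m) n (by omega)
        rw [e, Nat.add_sub_cancel, key]
        apply Submodule.neg_mem
        refine sum_mem_gqL hc fun k hk => ?_
        have := ih k hk (l + m - k) (m - k + n) (by omega)
        exact mem _ _ this.1 this.2
    exact ⟨_, this⟩
  · have : gdp x l * gdp z (n + m) * gdp x m ∈ CB x z ∧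
        mon x z l m n - gdp x l * gdp z (n + m) * gdp x m ∈ gqL (CB x z) := by
      induction m using Nat.strong_induction_on generalizing l n with
      | _ m ih =>
        refine ⟨⟨l, n + m, m, by omega, Or.inr rfl⟩, ?_⟩
        obtain ⟨c, hc, e⟩ := cb2 h h' l (n + m) m (by omega)
        rw [e, Nat.add_sub_cancel, key]
        apply Submodule.neg_mem
        refine sum_mem_gqL hc fun k hk => ?_
        have := ih k hk (l + (m - k)) (n + m - k) (by omega)
        exact mem _ _ this.1 this.2
    exact ⟨_, this⟩

lemma PB_PB {x z : A} (h : Serre x z) (h' : Serre z x) : Dir (PB x z) (PB z x) := by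
  refine (PB_CB h h').trans ?_
  rw [CB_symm]
  exact CB_PB h' h

end lat
end

noncomputable section
open scoped BigOperators

set_option linter.unusedSectionVars false

section weyl
variable {I : Type} [Fintype I] [DecidableEq I] (D : ADEData I)

def BF : LinearMap.BilinForm ℤ (I → ℤ) := Matrix.toBilin' (Matrix.of (cartan D))

lemma BF_apply (u v : I → ℤ) : BF D u v = ∑ i, ∑ j, u i * cartan D i j * v j :=
  Matrix.toBilin'_apply _ _ _

lemma cartan_symm (i j : I) : cartan D i j = cartan D j i := by
  simp only [cartan, cartanOf, eq_comm (a := i), D.symm i j]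

lemma cartan_self (i : I) : cartan D i i = 2 := by simp [cartan, cartanOf]

lemma BF_symm (u v : I → ℤ) : BF D u v = BF D v u := by
  rw [BF_apply, BF_apply, Finset.sum_comm]
  refine Finset.sum_congr rfl fun i _ => Finset.sum_congr rfl fun j _ => ?_
  rw [cartan_symm D j i]; ring

lemma pairing_eq (v : I → ℤ) (i : I) : pairing D v i = BF D v (simpleRoot i) := by
  simp [BF_apply, pairing, simpleRoot]

lemma BF_simple (i j : I) : BF D (simpleRoot i) (simpleRoot j) = cartan D i j := by
  rw [← pairing_eq]; simp [pairing, simpleRoot]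

lemma sref_eq (i : I) (v : I → ℤ) : sref D i v = v - BF D v (simpleRoot i) • simpleRoot i := by
  ext j; simp [sref, pairing_eq]

lemma sref_sub (i : I) (u v : I → ℤ) : sref D i (u - v) = sref D i u - sref D i v := by
  simp only [sref_eq, map_sub, LinearMap.sub_apply, sub_smul]; abel

lemma sref_smul (i : I) (c : ℤ) (v : I → ℤ) : sref D i (c • v) = c • sref D i v := by
  simp only [sref_eq, map_smul, LinearMap.smul_apply, smul_sub, smul_assoc]

lemma sref_simple (i : I) : sref D i (simpleRoot i) = - simpleRoot i := by
  rw [sref_eq, BF_simple, cartan_self, two_smul]; abel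

lemma sref_BF (i : I) (u v : I → ℤ) : BF D (sref D i u) (sref D i v) = BF D u v := by
  simp only [sref_eq, map_sub, LinearMap.sub_apply, map_smul, LinearMap.smul_apply, BF_simple,
    cartan_self, smul_eq_mul, BF_symm D (simpleRoot i) v]
  ring

lemma sref_sref (i : I) (v : I → ℤ) : sref D i (sref D i v) = v := by
  conv_lhs => rw [sref_eq D i v, sref_sub, sref_smul, sref_simple, sref_eq]
  simp

lemma act_append (l l' : List I) (v : I → ℤ) :
    wordAct D (l ++ l') v = wordAct D l (wordAct D l' v) := by
  induction l with
  | nil => rfl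
  | cons i l ih => simp [wordAct, ih]

lemma act_sub (l : List I) (u v : I → ℤ) :
    wordAct D l (u - v) = wordAct D l u - wordAct D l v := by
  induction l with
  | nil => rfl
  | cons i l ih => simp [wordAct, ih, sref_sub]

lemma act_zero (l : List I) : wordAct D l 0 = 0 := by
  simpa using act_sub D l 0 0

lemma act_neg (l : List I) (v : I → ℤ) : wordAct D l (-v) = - wordAct D l v := by
  simpa [act_zero] using act_sub D l 0 v

lemma act_add (l : List I) (u v : I → ℤ) :
    wordAct D l (u + v) = wordAct D l u + wordAct D l v := by
  rw [← sub_neg_eq_add, act_sub, act_neg, sub_neg_eq_add]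

lemma act_smul (l : List I) (c : ℤ) (v : I → ℤ) :
    wordAct D l (c • v) = c • wordAct D l v := by
  induction l with
  | nil => rfl
  | cons i l ih => simp only [wordAct, ih, sref_smul]

lemma act_BF (l : List I) (u v : I → ℤ) :
    BF D (wordAct D l u) (wordAct D l v) = BF D u v := by
  induction l with
  | nil => rfl
  | cons i l ih => simp [wordAct, ih, sref_BF]

lemma act_rev (l : List I) (v : I → ℤ) : wordAct D l (wordAct D l.reverse v) = v := by
  induction l generalizing v with
  | nil => rfl
  | cons i l ih =>
    simp only [List.reverse_cons, act_append, wordAct]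
    rw [ih, sref_sref]

lemma act_rev' (l : List I) (v : I → ℤ) : wordAct D l.reverse (wordAct D l v) = v := by
  simpa using act_rev D l.reverse v

lemma act_rev_congr {l l' : List I} (h : wordAct D l = wordAct D l') :
    wordAct D l.reverse = wordAct D l'.reverse := by
  funext v
  rw [← act_rev' D l' (wordAct D l.reverse v), ← h, act_rev]

lemma act_cons_congr {l l' : List I} (i : I) (h : wordAct D l = wordAct D l') :
    wordAct D (i :: l) = wordAct D (i :: l') := by
  funext v; simp [wordAct, h]

lemma act_cons_inj {l l' : List I} (i : I) (h : wordAct D (i :: l) = wordAct D (i :: l')) :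
    wordAct D l = wordAct D l' := by
  funext v
  have := congrArg (sref D i) (congrFun h v)
  simpa [wordAct, sref_sref] using this

lemma act_cons_cons (l : List I) (i : I) : wordAct D (i :: i :: l) = wordAct D l := by
  funext v; simp [wordAct, sref_sref]

lemma BF_pos (v : I → ℤ) (hv : v ≠ 0) : 0 < BF D v v := by
  have h := D.posdef (fun i => (v i : ℚ)) (by
    intro h; apply hv; funext i; have := congrFun h i; simpa using this)
  have e : ((BF D v v : ℤ) : ℚ) = ∑ i, ∑ j, (cartanOf D.adj i j : ℚ) * v i * v j := by
    rw [BF_apply]; push_cast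
    refine Finset.sum_congr rfl fun i _ => Finset.sum_congr rfl fun j _ => ?_
    simp only [cartan]; ring
  rw [← e] at h
  exact_mod_cast h

lemma BF_even (v : I → ℤ) : Even (BF D v v) := by
  rw [even_iff_two_dvd, ← Nat.cast_two, ← ZMod.intCast_zmod_eq_zero_iff_dvd, BF_apply,
    ← Finset.sum_product', Int.cast_sum]
  refine Finset.sum_involution (fun p _ => p.swap) ?_ ?_ ?_ ?_
  · rintro ⟨i, j⟩ _
    have : v j * cartan D j i * v i = v i * cartan D i j * v j := by
      rw [cartan_symm D j i]; ring
    simp only [Prod.swap]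
    rw [this]
    exact CharTwo.add_self_eq_zero _
  · rintro ⟨i, j⟩ _ h e
    apply h
    simp only [Prod.swap, Prod.mk.injEq] at e
    rw [e.1]
    simp only [cartan_self]
    push_cast
    rw [show (2 : ZMod 2) = 0 from rfl]; simp
  · simp
  · simp

lemma BF_two (v : I → ℤ) (hv : v ≠ 0) : 2 ≤ BF D v v := by
  have := BF_pos D v hv
  obtain ⟨r, hr⟩ := BF_even D v
  omega

lemma dichot (v : I → ℤ) (hv : BF D v v = 2) : 0 ≤ v ∨ v ≤ 0 := by
  set p : I → ℤ := fun i => max (v i) 0 with hp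
  set n : I → ℤ := fun i => max (-v i) 0 with hn
  have e : v = p - n := by
    funext i; simp only [hp, hn, Pi.sub_apply]; omega
  by_cases p0 : p = 0
  · right; intro i; have := congrFun p0 i; simp only [hp, Pi.zero_apply] at this ⊢; omega
  by_cases n0 : n = 0
  · left; intro i; have := congrFun n0 i; simp only [hn, Pi.zero_apply] at this ⊢; omega
  exfalso
  have h1 := BF_two D p p0
  have h2 := BF_two D n n0
  have h3 : BF D p n ≤ 0 := by
    rw [BF_apply]
    refine Finset.sum_nonpos fun i _ => Finset.sum_nonpos fun j _ => ?_
    by_cases hij : i = j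
    · subst hij
      have : p i * n i = 0 := by
        simp only [hp, hn]
        rcases le_total (v i) 0 with h | h
        · rw [max_eq_right h]; simp
        · rw [max_eq_right (a := -v i) (by omega)]; simp
      rw [mul_right_comm, this]; simp
    · have hc : cartan D i j ≤ 0 := by
        simp only [cartan, cartanOf, hij, if_false]; split <;> norm_num
      have hpi : 0 ≤ p i := le_max_right _ _
      have hnj : 0 ≤ n j := le_max_right _ _
      exact mul_nonpos_of_nonpos_of_nonneg (mul_nonpos_of_nonneg_of_nonpos hpi hc) hnj
  rw [e] at hv
  simp only [map_sub, LinearMap.sub_apply, BF_symm D n p] at hv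
  linarith

lemma norm_simple (l : List I) (i : I) :
    BF D (wordAct D l (simpleRoot i)) (wordAct D l (simpleRoot i)) = 2 := by
  rw [act_BF, BF_simple, cartan_self]

lemma not_both {v : I → ℤ} (hv : BF D v v = 2) (h : 0 ≤ v) (h' : v ≤ 0) : False := by
  have : v = 0 := le_antisymm h' h
  rw [this] at hv; simp at hv

lemma simple_nonneg (i : I) : (0 : I → ℤ) ≤ simpleRoot i := by
  intro j; simp only [simpleRoot, Pi.zero_apply]; split <;> norm_num

lemma sref_pos (j : I) (v : I → ℤ) (h0 : 0 ≤ v) (hv : BF D v v = 2) (hne : v ≠ simpleRoot j) :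
    0 ≤ sref D j v := by
  rcases dichot D (sref D j v) (by rw [sref_BF, hv]) with h | h
  · exact h
  exfalso
  have e : v = v j • simpleRoot j := by
    funext k
    by_cases hk : k = j
    · subst hk; simp [simpleRoot]
    · have h1 := h k
      simp [sref, simpleRoot, hk] at h1
      have h2 := h0 k
      simp at h2
      simp [simpleRoot, hk]; omega
  have h0j := h0 j
  simp only [Pi.zero_apply] at h0j
  rw [e] at hv
  simp only [map_smul, LinearMap.smul_apply, BF_simple, cartan_self, smul_eq_mul] at hv
  have : v j = 1 := by nlinarith
  rw [this, one_smul] at e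
  exact hne e

lemma exch_aux (l : List I) (v : I → ℤ) (h0 : 0 ≤ v) (hv : BF D v v = 2)
    (h : ¬ 0 ≤ wordAct D l.reverse v) :
    ∃ l1 j l2, l = l1 ++ j :: l2 ∧ wordAct D l1.reverse v = simpleRoot j := by
  induction l generalizing v with
  | nil => exact absurd h0 h
  | cons j l ih =>
    by_cases hj : v = simpleRoot j
    · exact ⟨[], j, l, rfl, hj⟩
    · simp only [List.reverse_cons, act_append, wordAct] at h
      obtain ⟨l1, k, l2, e, h2⟩ := ih (sref D j v) (sref_pos D j v h0 hv hj) (by rw [sref_BF, hv]) h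
      refine ⟨j :: l1, k, l2, by rw [e]; rfl, ?_⟩
      simp only [List.reverse_cons, act_append, wordAct]; exact h2

/-- left descent -/
def Des (l : List I) (i : I) : Prop := ¬ 0 ≤ wordAct D l.reverse (simpleRoot i)

lemma exchange (l : List I) (i : I) (h : Des D l i) :
    ∃ l', l'.length + 1 = l.length ∧ wordAct D (i :: l') = wordAct D l := by
  obtain ⟨l1, j, l2, e, h2⟩ := exch_aux D l (simpleRoot i) (simple_nonneg i)
    (by rw [BF_simple, cartan_self]) h
  refine ⟨l1 ++ l2, by simp [e]; omega, ?_⟩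
  have h3 : simpleRoot i = wordAct D l1 (simpleRoot j) := by rw [← h2, act_rev]
  funext v
  have key : ∀ u, sref D i (wordAct D l1 u) = wordAct D l1 (sref D j u) := by
    intro u
    rw [sref_eq, h3, act_BF, sref_eq, act_sub, act_smul]
  rw [e]
  simp only [wordAct, act_append, key]

lemma Des_congr {l l' : List I} (h : wordAct D l = wordAct D l') (i : I) : Des D l i ↔ Des D l' i := by
  rw [Des, Des, act_rev_congr D h]

lemma Des_cons (u : List I) (i : I) : Des D (i :: u) i ↔ ¬ Des D u i := by
  have hn := norm_simple D u.reverse i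
  simp only [Des, List.reverse_cons, act_append, wordAct, sref_simple, act_neg, not_not]
  constructor
  · intro h
    rcases dichot D _ hn with h1 | h1
    · exact h1
    · exact absurd (neg_nonneg.2 h1) h
  · intro h1 h
    exact not_both D hn h1 (neg_nonneg.1 h)

lemma red_des {u : List I} {i : I} (h : IsReducedWord D (i :: u)) : Des D (i :: u) i := by
  rw [Des_cons]
  intro hd
  obtain ⟨l', hl, e⟩ := exchange D u i hd
  have := h l' (by rw [act_cons_congr D i e.symm, act_cons_cons])
  simp at this; omega

lemma red_tail {u : List I} {i : I} (h : IsReducedWord D (i :: u)) : IsReducedWord D u := by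
  intro l hl
  have := h (i :: l) (act_cons_congr D i hl)
  simpa using this

lemma red_congr {l l' : List I} (h : IsReducedWord D l) (e : wordAct D l' = wordAct D l)
    (hl : l'.length = l.length) : IsReducedWord D l' := by
  intro k hk
  rw [hl]; exact h k (hk.trans e)

lemma exists_red (l : List I) : ∃ u, IsReducedWord D u ∧ wordAct D u = wordAct D l := by
  induction hn : l.length using Nat.strong_induction_on generalizing l with
  | _ n ih =>
    by_cases h : IsReducedWord D l
    · exact ⟨l, h, rfl⟩
    · simp only [IsReducedWord, not_forall, not_le] at h
      obtain ⟨k, hk, hlt⟩ := h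
      obtain ⟨u, hu, hu'⟩ := ih _ (hn ▸ hlt) k rfl
      exact ⟨u, hu, hu'.trans hk⟩

lemma longest_des {w : List I} (hw : IsRedW0 D w) (i : I) : Des D w i := by
  by_contra hd
  obtain ⟨u, hu, e⟩ := exists_red D (i :: w)
  have hd' : Des D u i := (Des_congr D e i).2 ((Des_cons D w i).2 hd)
  obtain ⟨l', hl, e'⟩ := exchange D u i hd'
  have h1 : wordAct D l' = wordAct D w := act_cons_inj D i (e'.trans e)
  have h2 := hw.1 l' h1
  have h3 := hw.2 u hu
  omega

lemma sum_simple (v : I → ℤ) : v = ∑ i, v i • simpleRoot i := by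
  funext j; simp [simpleRoot]

lemma act_sum (l : List I) (f : I → (I → ℤ)) :
    wordAct D l (∑ i, f i) = ∑ i, wordAct D l (f i) := by
  let g : (I → ℤ) →+ (I → ℤ) := ⟨⟨wordAct D l, act_zero D l⟩, act_add D l⟩
  exact map_sum g f _

lemma longest_neg {w : List I} (hw : IsRedW0 D w) (v : I → ℤ) (hv : 0 ≤ v) :
    wordAct D w.reverse v ≤ 0 := by
  rw [sum_simple v, act_sum]
  refine Finset.sum_nonpos fun i _ => ?_
  rw [act_smul]
  have h1 : wordAct D w.reverse (simpleRoot i) ≤ 0 := by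
    rcases dichot D _ (norm_simple D w.reverse i) with h | h
    · exact absurd h (longest_des D hw i)
    · exact h
  exact smul_nonpos_of_nonneg_of_nonpos (hv i) h1

lemma longest_unique {w w' : List I} (hw : IsRedW0 D w) (hw' : IsRedW0 D w') :
    wordAct D w = wordAct D w' := by
  obtain ⟨u, hu, e⟩ := exists_red D (w'.reverse ++ w)
  have hnd : ∀ i, ¬ Des D (w'.reverse ++ w) i := by
    intro i
    simp only [Des, List.reverse_append, List.reverse_reverse, act_append, not_not]
    have h1 : wordAct D w' (simpleRoot i) ≤ 0 := by
      rcases dichot D _ (norm_simple D w' i) with h | h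
      · have := longest_neg D hw' _ h
        rw [act_rev'] at this
        exact (not_both D (norm_simple D [] i) (simple_nonneg i) this).elim
      · exact h
    have h2 := longest_neg D hw _ (neg_nonneg.2 h1)
    rw [act_neg] at h2
    simpa using h2
  cases u with
  | nil =>
    funext v
    have := congrFun e v
    rw [act_append] at this
    simp only [wordAct] at this
    conv_rhs => rw [this]
    rw [act_rev]
  | cons i u => exact absurd ((Des_congr D e i).1 (red_des D hu)) (hnd i)

lemma sref_far {i j : I} (hne : i ≠ j) (h : D.adj i j = false) :
    sref D i (simpleRoot j) = simpleRoot j := by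
  rw [sref_eq, BF_simple, cartan_symm]
  simp [cartan, cartanOf, hne, h]

lemma adj_ne {i j : I} (h : D.adj i j = true) : i ≠ j := by
  rintro rfl; simp [D.irrefl] at h

lemma sref_adj {i j : I} (h : D.adj i j = true) :
    sref D i (simpleRoot j) = simpleRoot j + simpleRoot i := by
  rw [sref_eq, BF_simple, cartan_symm]
  simp [cartan, cartanOf, adj_ne D h, h]

lemma sref_comm {i j : I} (hne : i ≠ j) (h : D.adj i j = false) (v : I → ℤ) :
    sref D i (sref D j v) = sref D j (sref D i v) := by
  have h' : D.adj j i = false := by rw [D.symm]; exact h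
  conv_lhs => rw [sref_eq D j v, sref_sub, sref_smul, sref_far D hne h]
  conv_rhs => rw [sref_eq D i v, sref_sub, sref_smul, sref_far D hne.symm h']
  rw [sref_eq, sref_eq]; abel

lemma sref_braid {i j : I} (h : D.adj i j = true) (v : I → ℤ) :
    sref D i (sref D j (sref D i v)) = sref D j (sref D i (sref D j v)) := by
  have h' : D.adj j i = true := by rw [D.symm]; exact h
  have c1 : cartan D i j = -1 := by simp [cartan, cartanOf, adj_ne D h, h]
  have c2 : cartan D j i = -1 := by rw [cartan_symm, c1]
  simp only [sref_eq, map_sub, map_smul, LinearMap.sub_apply, LinearMap.smul_apply, BF_simple,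
    cartan_self, c1, c2, smul_eq_mul]
  module

lemma Des_cons_far {u : List I} {i j : I} (hne : i ≠ j) (h : D.adj i j = false)
    (hd : Des D (i :: u) j) : Des D u j := by
  simpa [Des, act_append, wordAct, sref_far D hne h] using hd

lemma Des_nonpos {u : List I} {i : I} : Des D u i ↔ wordAct D u.reverse (simpleRoot i) ≤ 0 := by
  have hn := norm_simple D u.reverse i
  constructor
  · intro h; exact (dichot D _ hn).resolve_left h
  · intro h h'; exact not_both D hn h' h

lemma matsumoto (R : List I → List I → Prop) (hrefl : ∀ l, R l l)
    (htrans : ∀ l l' l'', R l l' → R l' l'' → R l l'')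
    (hcons : ∀ i l l', R l l' → R (i :: l) (i :: l'))
    (hcomm : ∀ a b l, a ≠ b → D.adj a b = false → R (a :: b :: l) (b :: a :: l))
    (hbraid : ∀ a b l, D.adj a b = true → R (a :: b :: a :: l) (b :: a :: b :: l)) :
    ∀ (n : ℕ) (w w' : List I), w.length = n → IsReducedWord D w → IsReducedWord D w' →
      wordAct D w = wordAct D w' → R w w' := by
  intro n
  induction n with
  | zero =>
    intro w w' hn hw hw' e
    have h1 := hw' w e
    have : w = [] := List.length_eq_zero_iff.1 hn
    have : w' = [] := List.length_eq_zero_iff.1 (by omega)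
    subst w; subst w'; exact hrefl _
  | succ n ih =>
    intro w w' hn hw hw' e
    have hlen : w.length = w'.length := le_antisymm (hw w' e.symm) (hw' w e)
    match w, w', hn, hw, hw', e, hlen with
    | i :: u, j :: u', hn, hw, hw', e, hlen =>
    simp at hn hlen
    by_cases hij : i = j
    · subst hij
      exact hcons _ _ _ (ih u u' hn (red_tail D hw) (red_tail D hw') (act_cons_inj D i e))
    have hdi : Des D (i :: u) i := red_des D hw
    have hdj : Des D (i :: u) j := (Des_congr D e j).2 (red_des D hw')
    cases hadj : D.adj i j with
    | false =>
      have hd : Des D u j := Des_cons_far D hij hadj hdj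
      obtain ⟨u2, hl2, e2⟩ := exchange D u j hd
      have r1 : R (i :: u) (i :: j :: u2) := hcons _ _ _ <|
        ih u (j :: u2) hn (red_tail D hw) (red_congr D (red_tail D hw) e2 (by simpa using hl2)) e2.symm
      have e3 : wordAct D (j :: i :: u2) = wordAct D (j :: u') := by
        rw [← e, act_cons_congr D i e2.symm]
        funext v; exact (sref_comm D hij hadj _).symm
      have e4 := act_cons_inj D j e3
      have l4 : (i :: u2).length = u'.length := by simp; omega
      have r2 : R (j :: i :: u2) (j :: u') := hcons _ _ _ <|
        ih (i :: u2) u' (by omega) (red_congr D (red_tail D hw') e4 l4) (red_tail D hw') e4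
      exact htrans _ _ _ r1 (htrans _ _ _ (hcomm i j u2 hij hadj) r2)
    | true =>
      have hadj' : D.adj j i = true := by rw [D.symm]; exact hadj
      have g1 := (Des_nonpos D).1 hdi
      have g2 := (Des_nonpos D).1 hdj
      have hd : Des D u j := by
        rw [Des_nonpos]
        have : wordAct D u.reverse (simpleRoot j) =
            wordAct D (i :: u).reverse (simpleRoot i) + wordAct D (i :: u).reverse (simpleRoot j) := by
          simp only [List.reverse_cons, act_append, wordAct, sref_simple, sref_adj D hadj, act_neg,
            act_add]
          abel
        rw [this]; exact add_nonpos g1 g2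
      obtain ⟨u2, hl2, e2⟩ := exchange D u j hd
      have hd2 : Des D u2 i := by
        rw [Des_nonpos]
        have e5 : wordAct D (i :: j :: u2).reverse = wordAct D (i :: u).reverse :=
          act_rev_congr D (act_cons_congr D i e2)
        have : wordAct D u2.reverse (simpleRoot i) = wordAct D (i :: u).reverse (simpleRoot j) := by
          rw [← e5]
          simp only [List.reverse_cons, act_append, wordAct, sref_adj D hadj]
          congr 1
          rw [← sub_neg_eq_add, sref_sub, sref_simple, ← neg_one_smul ℤ (simpleRoot i), sref_smul,
            sref_adj D hadj']
          module
        rw [this]; exact g2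
      obtain ⟨u3, hl3, e3⟩ := exchange D u2 i hd2
      have e6 : wordAct D (j :: i :: u3) = wordAct D u := (act_cons_congr D j e3).trans e2
      have r1 : R (i :: u) (i :: j :: i :: u3) := hcons _ _ _ <|
        ih u (j :: i :: u3) hn (red_tail D hw)
          (red_congr D (red_tail D hw) e6 (by simp; omega)) e6.symm
      have e7 : wordAct D (j :: i :: j :: u3) = wordAct D (j :: u') := by
        rw [← e, act_cons_congr D i e6.symm]
        funext v; exact (sref_braid D hadj _).symm
      have e4 := act_cons_inj D j e7
      have l4 : (i :: j :: u3).length = u'.length := by simp; omega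
      have r2 : R (j :: i :: j :: u3) (j :: u') := hcons _ _ _ <|
        ih (i :: j :: u3) u' (by omega) (red_congr D (red_tail D hw') e4 l4) (red_tail D hw') e4
      exact htrans _ _ _ r1 (htrans _ _ _ (hbraid i j u3 hadj) r2)

end weyl
end

noncomputable section
open scoped BigOperators

section br
set_option linter.unusedSimpArgs false
variable {I : Type} [Fintype I] [DecidableEq I] {D : ADEData I}

lemma rel {a b : FA I} (h : QRel D a b) :
    RingQuot.mkAlgHom 𝕂 (QRel D) a = RingQuot.mkAlgHom 𝕂 (QRel D) b :=
  RingQuot.mkAlgHom_rel 𝕂 h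

lemma r_KKinv (i : I) : KK D i * KKinv D i = 1 := by
  have := rel (QRel.KKinv (D := D) i)
  simp only [map_mul, map_one, map_smul, map_sub, map_add, map_pow] at this
  exact this
lemma r_KinvK (i : I) : KKinv D i * KK D i = 1 := by
  have := rel (QRel.KinvK (D := D) i)
  simp only [map_mul, map_one, map_smul, map_sub, map_add, map_pow] at this
  exact this
lemma r_KK (i j : I) : KK D i * KK D j = KK D j * KK D i := by
  have := rel (QRel.KcommK (D := D) i j)
  simp only [map_mul, map_one, map_smul, map_sub, map_add, map_pow] at this
  exact this

lemma r_KFself (i : I) : KK D i * FF D i * KKinv D i = (qq ^ 2)⁻¹ • FF D i := by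
  have := rel (QRel.KFself (D := D) i)
  simp only [map_mul, map_one, map_smul, map_sub, map_add, map_pow] at this
  exact this
lemma r_KEself (i : I) : KK D i * EE D i * KKinv D i = (qq ^ 2) • EE D i := by
  have := rel (QRel.KEself (D := D) i)
  simp only [map_mul, map_one, map_smul, map_sub, map_add, map_pow] at this
  exact this
lemma r_EFdiff (i j : I) (h : i ≠ j) : EE D i * FF D j = FF D j * EE D i := by
  have := rel (QRel.EFdiff (D := D) i j h)
  rw [map_sub, map_mul, map_mul, map_zero] at this
  exact sub_eq_zero.1 this
lemma r_EFself (i : I) : EE D i * FF D i - FF D i * EE D i =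
    (qq - qq⁻¹)⁻¹ • (KK D i - KKinv D i) := by
  have := rel (QRel.EFself (D := D) i)
  simp only [map_mul, map_one, map_smul, map_sub, map_add, map_pow] at this
  exact this
lemma r_serreF (i j : I) (h : D.adj i j = true) : Serre (FF D i) (FF D j) := by
  have := rel (QRel.serreF (D := D) i j h)
  simp only [map_mul, map_smul, map_add, map_pow] at this
  exact this
lemma r_KEadj (i j : I) (h : D.adj i j = true) : KK D i * EE D j * KKinv D i = qq⁻¹ • EE D j := by
  have := rel (QRel.KEadj (D := D) i j h)
  simp only [map_mul, map_one, map_smul, map_sub, map_add, map_pow] at this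
  exact this
lemma r_KFadj (i j : I) (h : D.adj i j = true) : KK D i * FF D j * KKinv D i = qq • FF D j := by
  have := rel (QRel.KFadj (D := D) i j h)
  simp only [map_mul, map_one, map_smul, map_sub, map_add, map_pow] at this
  exact this
lemma r_EEfar (i j : I) (h : i ≠ j) (h' : D.adj i j = false) : EE D i * EE D j = EE D j * EE D i := by
  have := rel (QRel.EEfar (D := D) i j h h')
  simp only [map_mul, map_one, map_smul, map_sub, map_add, map_pow] at this
  exact this
lemma r_FFfar (i j : I) (h : i ≠ j) (h' : D.adj i j = false) : FF D i * FF D j = FF D j * FF D i := by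
  have := rel (QRel.FFfar (D := D) i j h h')
  simp only [map_mul, map_one, map_smul, map_sub, map_add, map_pow] at this
  exact this

/-- Algebra maps out of `U_q` agreeing on `E`, `F`, `K` are equal. -/
lemma Uq_ext (f g : Uq D →ₐ[𝕂] Uq D) (hE : ∀ i, f (EE D i) = g (EE D i))
    (hF : ∀ i, f (FF D i) = g (FF D i)) (hK : ∀ i, f (KK D i) = g (KK D i)) : f = g := by
  apply RingQuot.ringQuot_ext' 𝕂
  apply FreeAlgebra.hom_ext
  funext x
  cases x with
  | E i => exact hE i
  | F i => exact hF i
  | K i => exact hK i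
  | Kinv i =>
    change f (KKinv D i) = g (KKinv D i)
    have h1 : f (KKinv D i) * f (KK D i) = 1 := by rw [← map_mul, r_KinvK, map_one]
    have h2 : g (KK D i) * g (KKinv D i) = 1 := by rw [← map_mul, r_KKinv, map_one]
    rw [hK] at h1
    exact left_inv_eq_right_inv h1 h2

section comp
-- generic computations in a 𝕂-algebra
variable {A : Type} [Ring A] [Algebra 𝕂 A]

/-- `X K⁻¹ = c K⁻¹ X` from `K X K⁻¹ = c X`. -/
lemma conj1 {K L X : A} {c : 𝕂} (h2 : L * K = 1) (h : K * X * L = c • X) : X * L = c • (L * X) := by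
  rw [← mul_smul_comm, ← h, ← mul_assoc, ← mul_assoc, h2, one_mul]

lemma conj2 {K L X : A} {c : 𝕂} (h2 : L * K = 1) (h : K * X * L = c • X) : K * X = c • (X * K) := by
  rw [← smul_mul_assoc, ← h, mul_assoc, h2, mul_one]

lemma TTF {E F F' K L : A} (hL : L * K = 1)
    (hF : K * F * L = (qq ^ 2)⁻¹ • F) (hF' : K * F' * L = qq • F')
    (hEF : E * F - F * E = (qq - qq⁻¹)⁻¹ • (K - L)) (hEF' : E * F' = F' * E) :
    -(L * E) * (F' * F - qq • (F * F')) - qq • ((F' * F - qq • (F * F')) * -(L * E)) = F' := by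
  have hq := qq_ne
  have hd := qdiff_ne
  have k1 := conj1 hL hF
  have k2 := conj1 hL hF'
  have k3 := conj2 hL hF'
  have hEF2 : E * F = F * E + (qq - qq⁻¹)⁻¹ • (K - L) := by rw [← hEF]; abel
  set Y := F' * F - qq • (F * F') with hY
  have y1 : Y * L = qq⁻¹ • (L * Y) := by
    rw [hY, sub_mul, smul_mul_assoc, mul_assoc, mul_assoc, k1, k2, mul_smul_comm, mul_smul_comm,
      ← mul_assoc, ← mul_assoc, k1, k2, mul_sub, smul_sub]
    simp only [smul_mul_assoc, mul_smul_comm, smul_smul, mul_assoc]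
    congr 2 <;> field_simp
  have y2 : E * Y = Y * E + -(K * F') := by
    rw [hY, mul_sub, mul_smul_comm, ← mul_assoc, ← mul_assoc, hEF', hEF2, mul_assoc, hEF2, mul_add,
      add_mul, mul_assoc F E, hEF', sub_mul, smul_mul_assoc]
    have e1 : F' * (qq - qq⁻¹)⁻¹ • (K - L) = (qq - qq⁻¹)⁻¹ • (qq⁻¹ • (K * F') - qq • (L * F')) := by
      rw [mul_smul_comm, mul_sub, k2, k3, smul_smul, inv_mul_cancel₀ hq, one_smul]
    rw [e1]
    have e2 : -(K * F') = (qq - qq⁻¹)⁻¹ • ((qq⁻¹ - qq) • (K * F')) := by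
      rw [smul_smul, ← neg_sub qq, mul_neg, inv_mul_cancel₀ hd, neg_one_smul]
    rw [e2]
    simp only [smul_mul_assoc, sub_mul, mul_assoc]
    simp only [smul_add, smul_sub, sub_smul, smul_smul, mul_comm _ (qq - qq⁻¹)⁻¹]
    abel
  rw [mul_neg, neg_mul, mul_assoc, y2, ← mul_assoc, y1, mul_add, smul_mul_assoc, smul_neg, smul_smul,
    mul_inv_cancel₀ hq, one_smul, mul_neg, ← mul_assoc L K, hL, one_mul, mul_assoc]
  abel

lemma TTE {E F E' K L : A} (hL : L * K = 1) (hK : K * L = 1)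
    (hE : K * E * L = (qq ^ 2) • E) (hE' : K * E' * L = qq⁻¹ • E')
    (hEF : E * F - F * E = (qq - qq⁻¹)⁻¹ • (K - L)) (hEF' : E' * F = F * E') :
    (E * E' - qq⁻¹ • (E' * E)) * -(F * K) - qq⁻¹ • (-(F * K) * (E * E' - qq⁻¹ • (E' * E))) = E' := by
  have hq := qq_ne
  have hd := qdiff_ne
  have k1 := conj2 hL hE
  have k2 := conj2 hL hE'
  have k3 := conj1 hL hE'
  have hEF2 : E * F = F * E + (qq - qq⁻¹)⁻¹ • (K - L) := by rw [← hEF]; abel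
  set Y := E * E' - qq⁻¹ • (E' * E) with hY
  have y1 : K * Y = qq • (Y * K) := by
    rw [hY, mul_sub, mul_smul_comm, ← mul_assoc, ← mul_assoc, k1, k2, smul_mul_assoc, smul_mul_assoc,
      mul_assoc, mul_assoc, k1, k2, sub_mul, smul_sub]
    simp only [smul_mul_assoc, mul_smul_comm, smul_smul, mul_assoc]
    congr 2 <;> field_simp
  have y2 : Y * F = F * Y + -(E' * L) := by
    rw [hY, sub_mul, smul_mul_assoc, mul_assoc, mul_assoc, hEF', hEF2, mul_add, ← mul_assoc, hEF2,
      ← mul_assoc, hEF', add_mul]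
    have e1 : (qq - qq⁻¹)⁻¹ • (K - L) * E' = (qq - qq⁻¹)⁻¹ • (qq⁻¹ • (E' * K) - qq • (E' * L)) := by
      rw [smul_mul_assoc, sub_mul, k3, k2, smul_smul, mul_inv_cancel₀ hq, one_smul]
    rw [e1]
    have e2 : -(E' * L) = (qq - qq⁻¹)⁻¹ • ((qq⁻¹ - qq) • (E' * L)) := by
      rw [smul_smul, ← neg_sub qq, mul_neg, inv_mul_cancel₀ hd, neg_one_smul]
    rw [e2]
    simp only [mul_smul_comm, mul_sub, mul_assoc]
    simp only [smul_add, smul_sub, sub_smul, smul_smul, mul_comm _ (qq - qq⁻¹)⁻¹]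
    abel
  rw [mul_neg, neg_mul, ← mul_assoc, y2, mul_assoc, y1, add_mul, mul_smul_comm, smul_neg, smul_smul,
    inv_mul_cancel₀ hq, one_smul, neg_mul, mul_assoc E', hL, mul_one, mul_assoc]
  abel

lemma far3 {x y c : A} (r s : 𝕂) (h : x * y = y * x) :
    (c * x - r • (x * c)) * y - s • (y * (c * x - r • (x * c))) =
    (c * y - s • (y * c)) * x - r • (x * (c * y - s • (y * c))) := by
  simp only [sub_mul, mul_sub, smul_sub, smul_mul_assoc, mul_smul_comm, smul_smul]
  rw [mul_assoc c x y, h, ← mul_assoc c y x, ← mul_assoc x y c, h, mul_assoc, mul_assoc, mul_assoc,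
    mul_assoc, mul_comm r s]
  abel

lemma far3' {x y c : A} (r s : 𝕂) (h : x * y = y * x) :
    y * (x * c - r • (c * x)) - s • ((x * c - r • (c * x)) * y) =
    x * (y * c - s • (c * y)) - r • ((y * c - s • (c * y)) * x) := by
  simp only [sub_mul, mul_sub, smul_sub, smul_mul_assoc, mul_smul_comm, smul_smul]
  have h2 : y * (x * c) = x * (y * c) := by rw [← mul_assoc, ← h, mul_assoc]
  have h3 : c * x * y = c * y * x := by rw [mul_assoc, h, mul_assoc]
  rw [h2, h3, mul_comm r s]
  simp only [mul_assoc]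
  abel

end comp

variable {T : I → (Uq D ≃ₐ[𝕂] Uq D)}

lemma tFs (hT : IsLusztigAuts D T) (i : I) : T i (FF D i) = -(KKinv D i * EE D i) := (hT i i).1
lemma tEs (hT : IsLusztigAuts D T) (i : I) : T i (EE D i) = -(FF D i * KK D i) := (hT i i).2.2.2.1
lemma tKs (hT : IsLusztigAuts D T) (i : I) : T i (KK D i) = KKinv D i := (hT i i).2.2.2.2.2.2.1
lemma tFa (hT : IsLusztigAuts D T) {i j : I} (h : D.adj i j = true) :
    T i (FF D j) = FF D j * FF D i - qq • (FF D i * FF D j) := (hT i j).2.1 h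
lemma tEa (hT : IsLusztigAuts D T) {i j : I} (h : D.adj i j = true) :
    T i (EE D j) = EE D i * EE D j - qq⁻¹ • (EE D j * EE D i) := (hT i j).2.2.2.2.1 h
lemma tKa (hT : IsLusztigAuts D T) {i j : I} (h : D.adj i j = true) :
    T i (KK D j) = KK D i * KK D j := (hT i j).2.2.2.2.2.2.2.1 h
lemma tFf (hT : IsLusztigAuts D T) {i j : I} (hn : i ≠ j) (h : D.adj i j = false) :
    T i (FF D j) = FF D j := (hT i j).2.2.1 hn h
lemma tEf (hT : IsLusztigAuts D T) {i j : I} (hn : i ≠ j) (h : D.adj i j = false) :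
    T i (EE D j) = EE D j := (hT i j).2.2.2.2.2.1 hn h
lemma tKf (hT : IsLusztigAuts D T) {i j : I} (hn : i ≠ j) (h : D.adj i j = false) :
    T i (KK D j) = KK D j := (hT i j).2.2.2.2.2.2.2.2 hn h

lemma inv_congr {x x' y : Uq D} (h1 : x * x' = 1) {k : I} (h2 : y * KK D k = 1)
    (h : x = KK D k) : x' = y := by
  rw [h] at h1
  exact (left_inv_eq_right_inv h2 h1).symm

lemma t_inv (i k : I) {y y' : Uq D} (h : T i (KK D k) = y) (hy : y' * y = 1) :
    T i (KKinv D k) = y' := by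
  have h1 : T i (KK D k) * T i (KKinv D k) = 1 := by rw [← map_mul, r_KKinv, map_one]
  rw [h] at h1
  exact (left_inv_eq_right_inv hy h1).symm

lemma tLf (hT : IsLusztigAuts D T) {i j : I} (hn : i ≠ j) (h : D.adj i j = false) :
    T i (KKinv D j) = KKinv D j := t_inv i j (tKf hT hn h) (r_KinvK j)
lemma tLs (hT : IsLusztigAuts D T) (i : I) : T i (KKinv D i) = KK D i :=
  t_inv i i (tKs hT i) (r_KKinv i)

lemma ttF (hT : IsLusztigAuts D T) {a b : I} (h : D.adj a b = true) :
    T a (T b (FF D a)) = FF D b := by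
  have h' : D.adj b a = true := by rw [D.symm]; exact h
  rw [tFa hT h', map_sub, map_smul, map_mul, map_mul, tFs hT, tFa hT h]
  exact TTF (r_KinvK a) (r_KFself a) (r_KFadj a b h) (r_EFself a) (r_EFdiff a b (adj_ne D h))

lemma ttE (hT : IsLusztigAuts D T) {a b : I} (h : D.adj a b = true) :
    T a (T b (EE D a)) = EE D b := by
  have h' : D.adj b a = true := by rw [D.symm]; exact h
  rw [tEa hT h', map_sub, map_smul, map_mul, map_mul, tEs hT, tEa hT h]
  exact TTE (r_KinvK a) (r_KKinv a) (r_KEself a) (r_KEadj a b h) (r_EFself a)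
    (r_EFdiff b a (adj_ne D h'))

lemma ttK (hT : IsLusztigAuts D T) {a b : I} (h : D.adj a b = true) :
    T a (T b (KK D a)) = KK D b := by
  have h' : D.adj b a = true := by rw [D.symm]; exact h
  rw [tKa hT h', map_mul, tKs hT, tKa hT h, r_KK a b, mul_assoc, r_KKinv, mul_one]

lemma ttL (hT : IsLusztigAuts D T) {a b : I} (h : D.adj a b = true) :
    T a (T b (KKinv D a)) = KKinv D b := by
  have h1 : T a (T b (KK D a)) * T a (T b (KKinv D a)) = 1 := by
    rw [← map_mul, ← map_mul, r_KKinv, map_one, map_one]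
  rw [ttK hT h] at h1
  exact (left_inv_eq_right_inv (r_KinvK b) h1).symm

lemma T_comm (hT : IsLusztigAuts D T) {a b : I} (hn : a ≠ b) (h : D.adj a b = false) (u : Uq D) :
    T a (T b u) = T b (T a u) := by
  have h' : D.adj b a = false := by rw [D.symm]; exact h
  have key : (T a).toAlgHom.comp (T b).toAlgHom = (T b).toAlgHom.comp (T a).toAlgHom := by
    apply Uq_ext
    · intro c
      change T a (T b (EE D c)) = T b (T a (EE D c))
      by_cases hca : a = c
      · subst hca
        rw [tEf hT hn.symm h', tEs hT, map_neg, map_mul, tFf hT hn.symm h', tKf hT hn.symm h']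
      by_cases hcb : b = c
      · subst hcb
        rw [tEf hT hn h, tEs hT, map_neg, map_mul, tFf hT hn h, tKf hT hn h]
      cases h1 : D.adj a c <;> cases h2 : D.adj b c
      · simp only [tEf hT hca h1, tEf hT hcb h2]
      · simp only [tEf hT hca h1, tEa hT h2, map_sub, map_mul, map_smul, tEf hT hn h]
      · simp only [tEa hT h1, tEf hT hcb h2, map_sub, map_mul, map_smul, tEf hT hn.symm h']
      · simp only [tEa hT h1, tEa hT h2, map_sub, map_mul, map_smul, tEf hT hn h, tEf hT hn.symm h']
        exact far3' _ _ (r_EEfar a b hn h)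
    · intro c
      change T a (T b (FF D c)) = T b (T a (FF D c))
      by_cases hca : a = c
      · subst hca
        rw [tFf hT hn.symm h', tFs hT, map_neg, map_mul, tEf hT hn.symm h', tLf hT hn.symm h']
      by_cases hcb : b = c
      · subst hcb
        rw [tFf hT hn h, tFs hT, map_neg, map_mul, tEf hT hn h, tLf hT hn h]
      cases h1 : D.adj a c <;> cases h2 : D.adj b c
      · simp only [tFf hT hca h1, tFf hT hcb h2]
      · simp only [tFf hT hca h1, tFa hT h2, map_sub, map_mul, map_smul, tFf hT hn h]
      · simp only [tFa hT h1, tFf hT hcb h2, map_sub, map_mul, map_smul, tFf hT hn.symm h']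
      · simp only [tFa hT h1, tFa hT h2, map_sub, map_mul, map_smul, tFf hT hn h, tFf hT hn.symm h']
        exact far3 _ _ (r_FFfar a b hn h)
    · intro c
      change T a (T b (KK D c)) = T b (T a (KK D c))
      by_cases hca : a = c
      · subst hca
        rw [tKf hT hn.symm h', tKs hT, tLf hT hn.symm h']
      by_cases hcb : b = c
      · subst hcb
        rw [tKf hT hn h, tKs hT, tLf hT hn h]
      cases h1 : D.adj a c <;> cases h2 : D.adj b c
      · simp only [tKf hT hca h1, tKf hT hcb h2]
      · simp only [tKf hT hca h1, tKa hT h2, map_mul, tKf hT hn h]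
      · simp only [tKa hT h1, tKf hT hcb h2, map_mul, tKf hT hn.symm h']
      · simp only [tKa hT h1, tKa hT h2, map_mul, tKf hT hn h, tKf hT hn.symm h']
        rw [← mul_assoc, r_KK b a, mul_assoc]
  exact DFunLike.congr_fun key u

lemma no_triangle {a b c : I} (h1 : D.adj a b = true) (h2 : D.adj a c = true)
    (h3 : D.adj b c = true) : False := by
  have c1 : cartan D a b = -1 := by simp [cartan, cartanOf, adj_ne D h1, h1]
  have c2 : cartan D a c = -1 := by simp [cartan, cartanOf, adj_ne D h2, h2]
  have c3 : cartan D b c = -1 := by simp [cartan, cartanOf, adj_ne D h3, h3]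
  have e : BF D (simpleRoot a + simpleRoot b + simpleRoot c)
      (simpleRoot a + simpleRoot b + simpleRoot c) = 0 := by
    simp only [map_add, LinearMap.add_apply, BF_simple, cartan_self, c1, c2, c3,
      cartan_symm D b a, cartan_symm D c a, cartan_symm D c b]
    norm_num
  have hne : simpleRoot a + simpleRoot b + simpleRoot c ≠ 0 := by
    intro h
    have := congrFun h a
    simp [simpleRoot, adj_ne D h1, adj_ne D h2] at this
  have := BF_pos D _ hne
  omega

/-- braid relation on a generator adjacent to `a` only, in both directions -/
lemma braid_F1 (hT : IsLusztigAuts D T) {a b c : I} (h : D.adj a b = true) (hbc : b ≠ c)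
    (h1 : D.adj a c = true) (h2 : D.adj b c = false) :
    T a (T b (T a (FF D c))) = T b (T a (T b (FF D c))) := by
  have h' : D.adj b a = true := by rw [D.symm]; exact h
  simp only [tFf hT hbc h2, tFa hT h1, map_sub, map_mul, map_smul, ttF hT h]
  simp only [tFa hT h', map_sub, map_mul, map_smul]
  simp only [sub_mul, mul_sub, smul_sub, smul_mul_assoc, mul_smul_comm, smul_smul]
  have := r_FFfar b c hbc h2
  simp only [mul_assoc, ← this]
  simp only [← mul_assoc, ← this]
  abel

lemma braid_E1 (hT : IsLusztigAuts D T) {a b c : I} (h : D.adj a b = true) (hbc : b ≠ c)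
    (h1 : D.adj a c = true) (h2 : D.adj b c = false) :
    T a (T b (T a (EE D c))) = T b (T a (T b (EE D c))) := by
  have h' : D.adj b a = true := by rw [D.symm]; exact h
  simp only [tEf hT hbc h2, tEa hT h1, map_sub, map_mul, map_smul, ttE hT h]
  simp only [tEa hT h', map_sub, map_mul, map_smul]
  simp only [sub_mul, mul_sub, smul_sub, smul_mul_assoc, mul_smul_comm, smul_smul]
  have := r_EEfar b c hbc h2
  simp only [mul_assoc, ← this]
  simp only [← mul_assoc, ← this]
  abel

lemma braid_K1 (hT : IsLusztigAuts D T) {a b c : I} (h : D.adj a b = true) (hbc : b ≠ c)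
    (h1 : D.adj a c = true) (h2 : D.adj b c = false) :
    T a (T b (T a (KK D c))) = T b (T a (T b (KK D c))) := by
  have h' : D.adj b a = true := by rw [D.symm]; exact h
  simp only [tKf hT hbc h2, tKa hT h1, map_mul, ttK hT h]
  simp only [tKa hT h', map_sub, map_mul, map_smul]
  rw [mul_assoc]

lemma T_braid (hT : IsLusztigAuts D T) {a b : I} (h : D.adj a b = true) (u : Uq D) :
    T a (T b (T a u)) = T b (T a (T b u)) := by
  have h' : D.adj b a = true := by rw [D.symm]; exact h
  have key : (T a).toAlgHom.comp ((T b).toAlgHom.comp (T a).toAlgHom) =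
      (T b).toAlgHom.comp ((T a).toAlgHom.comp (T b).toAlgHom) := by
    apply Uq_ext
    · intro c
      change T a (T b (T a (EE D c))) = T b (T a (T b (EE D c)))
      by_cases hca : a = c
      · subst hca
        rw [ttE hT h, tEs hT, tEs hT, map_neg, map_neg, map_mul, map_mul, ttF hT h, ttK hT h]
      by_cases hcb : b = c
      · subst hcb
        rw [ttE hT h', tEs hT, tEs hT, map_neg, map_neg, map_mul, map_mul, ttF hT h', ttK hT h']
      cases h1 : D.adj a c <;> cases h2 : D.adj b c
      · simp only [tEf hT hca h1, tEf hT hcb h2]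
      · exact (braid_E1 hT h' hca h2 h1).symm
      · exact braid_E1 hT h hcb h1 h2
      · exact (no_triangle h h1 h2).elim
    · intro c
      change T a (T b (T a (FF D c))) = T b (T a (T b (FF D c)))
      by_cases hca : a = c
      · subst hca
        rw [ttF hT h, tFs hT, tFs hT, map_neg, map_neg, map_mul, map_mul, ttE hT h, ttL hT h]
      by_cases hcb : b = c
      · subst hcb
        rw [ttF hT h', tFs hT, tFs hT, map_neg, map_neg, map_mul, map_mul, ttE hT h', ttL hT h']
      cases h1 : D.adj a c <;> cases h2 : D.adj b c
      · simp only [tFf hT hca h1, tFf hT hcb h2]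
      · exact (braid_F1 hT h' hca h2 h1).symm
      · exact braid_F1 hT h hcb h1 h2
      · exact (no_triangle h h1 h2).elim
    · intro c
      change T a (T b (T a (KK D c))) = T b (T a (T b (KK D c)))
      by_cases hca : a = c
      · subst hca
        rw [ttK hT h, tKs hT, tKs hT, ttL hT h]
      by_cases hcb : b = c
      · subst hcb
        rw [ttK hT h', tKs hT, tKs hT, ttL hT h']
      cases h1 : D.adj a c <;> cases h2 : D.adj b c
      · simp only [tKf hT hca h1, tKf hT hcb h2]
      · exact (braid_K1 hT h' hca h2 h1).symm
      · exact braid_K1 hT h hcb h1 h2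
      · exact (no_triangle h h1 h2).elim
  exact DFunLike.congr_fun key u

end br
end

noncomputable section
open scoped BigOperators

section fin
variable {I : Type} [Fintype I] [DecidableEq I] {D : ADEData I}

instance instTowerUq (D : ADEData I) : @IsScalarTower (Polynomial ℤ) 𝕂 (Uq D) _ _
    (instModulePolynomialIntUq D).toDistribMulAction.toDistribSMul.toSMulZeroClass.toSMul :=
  @IsScalarTower.mk _ _ _ _ _
    (instModulePolynomialIntUq D).toDistribMulAction.toDistribSMul.toSMulZeroClass.toSMul (by
    intro p c x
    change (p • c) • x = (algebraMap (Polynomial ℤ) 𝕂 p) • (c • x)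
    rw [smul_smul, Algebra.smul_def p c])

variable (T : I → (Uq D ≃ₐ[𝕂] Uq D))

/-- The set of PBW monomials, recursively. -/
def MM : List I → Set (Uq D)
  | [] => {1}
  | i :: w => {u | ∃ n, ∃ m ∈ MM w, u = gdp (FF D i) n * T i m}

lemma map_gdp (f : Uq D ≃ₐ[𝕂] Uq D) (x : Uq D) (n : ℕ) : f (gdp x n) = gdp (f x) n := by
  simp only [gdp, map_smul, map_pow]

lemma pbw_cons (i : I) (w : List I) (a : Fin (i :: w).length → ℕ) :
    pbw T (i :: w) a = gdp (FF D i) (a 0) * T i (pbw T w (fun k => a k.succ)) := by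
  unfold pbw
  have h : List.finRange (i :: w).length =
      (0 : Fin (w.length + 1)) :: (List.finRange w.length).map Fin.succ := List.finRange_succ
  rw [h, List.map_cons, List.prod_cons, map_list_prod, List.map_map, List.map_map]
  congr 2
  apply List.map_congr_left
  intro k _
  change gdp _ _ = T i (gdp _ _)
  rw [map_gdp]
  rfl

lemma range_pbw (w : List I) : Set.range (pbw T w) = MM T w := by
  induction w with
  | nil =>
    ext u
    simp only [Set.mem_range, MM, Set.mem_singleton_iff]
    constructor
    · rintro ⟨a, rfl⟩; rfl
    · rintro rfl; exact ⟨fun _ => 0, rfl⟩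
  | cons i w ih =>
    ext u
    simp only [Set.mem_range, MM, Set.mem_ofPred_eq]
    constructor
    · rintro ⟨a, rfl⟩
      exact ⟨a 0, _, by rw [← ih]; exact ⟨_, rfl⟩, pbw_cons T i w a⟩
    · rintro ⟨n, m, hm, rfl⟩
      rw [← ih] at hm
      obtain ⟨b, rfl⟩ := hm
      refine ⟨Fin.cons n b, ?_⟩
      rw [pbw_cons]
      rfl

lemma latt_eq (w : List I) : latt T w = gL (MM T w) := by
  unfold latt; rw [range_pbw]

lemma qlatt_eq (w : List I) : qlatt T w = gqL (MM T w) := by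
  unfold qlatt; rw [latt_eq]; rfl

lemma gdp_comm {x y : Uq D} (h : x * y = y * x) (n m : ℕ) :
    gdp x n * gdp y m = gdp y m * gdp x n := by
  have : Commute (x ^ n) (y ^ m) := Commute.pow_pow h n m
  simp only [gdp, smul_mul_assoc, mul_smul_comm, this.eq]
  rw [smul_comm]

variable {T}

lemma dir_cons (i : I) (l l' : List I) (h : Dir (MM T l) (MM T l')) :
    Dir (MM T (i :: l)) (MM T (i :: l')) := by
  rintro u ⟨n, m, hm, rfl⟩
  obtain ⟨m', hm', hd⟩ := h m hm
  refine ⟨_, ⟨n, m', hm', rfl⟩, ?_⟩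
  have := gqL_map (S' := MM T (i :: l'))
    ((LinearMap.mulLeft 𝕂 (gdp (FF D i) n)).comp (T i).toLinearMap)
    (fun s hs => Submodule.subset_span ⟨n, s, hs, rfl⟩) hd
  simpa [mul_sub] using this

lemma dir_comm (hT : IsLusztigAuts D T) (a b : I) (l : List I) (hn : a ≠ b)
    (h : D.adj a b = false) : Dir (MM T (a :: b :: l)) (MM T (b :: a :: l)) := by
  have h' : D.adj b a = false := by rw [D.symm]; exact h
  rintro u ⟨n, m, ⟨k, v, hv, rfl⟩, rfl⟩
  refine ⟨_, ⟨k, _, ⟨n, v, hv, rfl⟩, rfl⟩, ?_⟩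
  rw [map_mul, map_mul, map_gdp, map_gdp, tFf hT hn h, tFf hT hn.symm h', ← mul_assoc, ← mul_assoc,
    gdp_comm (r_FFfar a b hn h), T_comm hT hn h, sub_self]
  exact Submodule.zero_mem _

lemma mm3 (hT : IsLusztigAuts D T) (a b : I) (h : D.adj a b = true) (n m k : ℕ) (v : Uq D) :
    gdp (FF D a) n * T a (gdp (FF D b) m * T b (gdp (FF D a) k * T a v)) =
      mon (FF D a) (FF D b) n m k * T a (T b (T a v)) := by
  simp only [map_mul, map_gdp, ttF hT h, mon]
  rw [tFa hT h]
  simp only [mul_assoc]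
  rfl

lemma dir_braid (hT : IsLusztigAuts D T) (a b : I) (l : List I)
    (h : D.adj a b = true) : Dir (MM T (a :: b :: a :: l)) (MM T (b :: a :: b :: l)) := by
  have h' : D.adj b a = true := by rw [D.symm]; exact h
  rintro u ⟨n, _, ⟨m, _, ⟨k, v, hv, rfl⟩, rfl⟩, rfl⟩
  rw [mm3 hT a b h]
  obtain ⟨s, ⟨n', m', k', rfl⟩, hd⟩ := PB_PB (r_serreF a b h) (r_serreF b a h')
    (mon (FF D a) (FF D b) n m k) ⟨n, m, k, rfl⟩
  have key : ∀ n' m' k', mon (FF D b) (FF D a) n' m' k' * T a (T b (T a v)) ∈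
      MM T (b :: a :: b :: l) := by
    intro n' m' k'
    rw [T_braid hT h, ← mm3 hT b a h']
    exact ⟨n', _, ⟨m', _, ⟨k', v, hv, rfl⟩, rfl⟩, rfl⟩
  refine ⟨_, key n' m' k', ?_⟩
  have := gqL_map (S' := MM T (b :: a :: b :: l))
    (LinearMap.mulRight 𝕂 (T a (T b (T a v))))
    (by rintro s ⟨n', m', k', rfl⟩; exact Submodule.subset_span (key n' m' k')) hd
  simpa [sub_mul] using this

lemma dir_main (hT : IsLusztigAuts D T) {w w' : List I} (hw : IsRedW0 D w) (hw' : IsRedW0 D w') :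
    Dir (MM T w) (MM T w') :=
  matsumoto D (fun w w' => Dir (MM T w) (MM T w')) (fun _ => Dir.refl _)
    (fun _ _ _ h1 h2 => Dir.trans h1 h2) dir_cons (dir_comm hT) (dir_braid hT)
    _ w w' rfl hw.1 hw'.1 (longest_unique D hw hw')

end fin
end

/-- The basis `B_i + q𝓛` of `𝓛/q𝓛` is independent of the
reduced expression `i` of `w₀`: the lattices agree and every PBW monomial of
one word is congruent mod `q𝓛` to a PBW monomial of the other. -/
theorem pbw_residues_independent_of_reduced_word
    {I : Type} [Fintype I] [DecidableEq I] (D : ADEData I)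
    (T : I → (Uq D ≃ₐ[𝕂] Uq D)) (hT : IsLusztigAuts D T)
    (w w' : List I) (hw : IsRedW0 D w) (hw' : IsRedW0 D w') :
    latt T w = latt T w' ∧
    (∀ a : Fin w.length → ℕ, ∃ a' : Fin w'.length → ℕ,
      pbw T w a - pbw T w' a' ∈ qlatt T w) ∧
    (∀ a' : Fin w'.length → ℕ, ∃ a : Fin w.length → ℕ,
      pbw T w' a' - pbw T w a ∈ qlatt T w) := by
  have d1 := dir_main hT hw hw'
  have d2 := dir_main hT hw' hw
  have hL : latt T w = latt T w' := by
    rw [latt_eq, latt_eq]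
    exact le_antisymm (Submodule.span_le.2 d1.le) (Submodule.span_le.2 d2.le)
  have hq : qlatt T w = qlatt T w' := by unfold qlatt; rw [hL]
  refine ⟨hL, fun a => ?_, fun a => ?_⟩
  · obtain ⟨s, hs, hd⟩ := d1 (pbw T w a) (by rw [← range_pbw]; exact ⟨a, rfl⟩)
    rw [← range_pbw] at hs
    obtain ⟨a', rfl⟩ := hs
    exact ⟨a', by rw [hq, qlatt_eq]; exact hd⟩
  · obtain ⟨s, hs, hd⟩ := d2 (pbw T w' a) (by rw [← range_pbw]; exact ⟨a, rfl⟩)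
    rw [← range_pbw] at hs
    obtain ⟨a', rfl⟩ := hs
    exact ⟨a', by rw [qlatt_eq]; exact hd⟩
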